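/- If B is a bumpless pipe dream for a vexillary permutation and B' = H_{ij}(B) is also a bumpless pipe dream for a vexillary permutation, then the Weigandt tableaux coincide: γ(B) = γ(B'). -/

import Mathlib

/- Common definitions for formalizing "Lenart's bijection via bumpless pipe dreams"
   (Gregory–Hamaker). -/

namespace BPDPaper

/-! ### Permutations of the positive integers -/

/-- We model permutations of the positive integers as permutations of `ℕ`
(fixing `0`, with finite support). -/
abbrev Perm' := Equiv.Perm ℕ

/-- The simple transposition `s_a = t_{a,a+1}`. -/
def sT (a : ℕ) : Perm' := Equiv.swap a (a + 1)

/-- The transposition `t_{ij}`. -/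
def tT (i j : ℕ) : Perm' := Equiv.swap i j

/-- The product `s_{a_1} ⋯ s_{a_p}` of a word. -/
def wordProd (l : List ℕ) : Perm' := (l.map sT).prod

/-- `l` is a word for `w` (in the letters `s_1, s_2, …`). -/
def IsWord (w : Perm') (l : List ℕ) : Prop := (∀ x ∈ l, 1 ≤ x) ∧ wordProd l = w

/-- The Coxeter length `ℓ(w)`: the minimal length of a word for `w`. -/
noncomputable def plen (w : Perm') : ℕ :=
  sInf {m | ∃ l : List ℕ, IsWord w l ∧ l.length = m}

/-- `l` is a reduced word for `w`. -/
def IsReducedWord (w : Perm') (l : List ℕ) : Prop := IsWord w l ∧ l.length = plen w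

/-- A permutation of the positive integers: fixes `0` and all but finitely many points. -/
def IsPerm (w : Perm') : Prop := w 0 = 0 ∧ {k | w k ≠ k}.Finite

/-- `k` is a descent of `w`. -/
def Descent (w : Perm') (k : ℕ) : Prop := 1 ≤ k ∧ w (k + 1) < w k

/-- `w` is Grassmannian: at most one descent. -/
def Grassmannian (w : Perm') : Prop := IsPerm w ∧ Set.Subsingleton {k | Descent w k}

/-- `w` is vexillary: no indices `i < j < k < l` with `w j < w i < w l < w k`
(pattern 2143 avoidance). -/
def Vexillary (w : Perm') : Prop := IsPerm w ∧
  ¬ ∃ i j k l : ℕ, 1 ≤ i ∧ i < j ∧ j < k ∧ k < l ∧ w j < w i ∧ w i < w l ∧ w l < w k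

/-- The code `c_i(w) = #{j > i : w j < w i}`. -/
noncomputable def codeOf (w : Perm') (i : ℕ) : ℕ := Nat.card {j : ℕ | i < j ∧ w j < w i}

/-- Insert into a weakly decreasing list, keeping it weakly decreasing. -/
def insDesc (x : ℕ) : List ℕ → List ℕ
  | [] => [x]
  | y :: ys => if y < x then x :: y :: ys else y :: insDesc x ys

/-- Sort a list into weakly decreasing order. -/
def sortDesc (l : List ℕ) : List ℕ := l.foldr insDesc []

/-- The shape `λ(w)`: the code `(c_1(w), …, c_n(w))` sorted decreasingly, zeros dropped
(`n` is any bound on the support of `w`). -/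
noncomputable def shapeOf (w : Perm') (n : ℕ) : List ℕ :=
  (sortDesc ((List.range' 1 n).map (codeOf w))).filter (fun x => decide (0 < x))

/-- The Rothe diagram `D_w = {(i, w j) : i < j, w j < w i}` (matrix coordinates). -/
def RotheDiagram (w : Perm') : Set (ℕ × ℕ) :=
  {p | 1 ≤ p.1 ∧ ∃ j, p.1 < j ∧ w j < w p.1 ∧ p.2 = w j}

/-- `φ_i`: the row index of the southeast-most box of `D_w` on the diagonal through
`(i, λ_i)`. -/
noncomputable def flagEntry (w : Perm') (i li : ℕ) : ℕ :=
  sSup {r : ℕ | ∃ c : ℕ, (r, c) ∈ RotheDiagram w ∧ (c : ℤ) - (r : ℤ) = (li : ℤ) - (i : ℤ)}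

/-- The flag `φ(w) = (φ_1, …, φ_m)` of a vexillary permutation. -/
noncomputable def flagOf (w : Perm') (n : ℕ) : List ℕ :=
  (List.range (shapeOf w n).length).map (fun k => flagEntry w (k + 1) ((shapeOf w n).getD k 0))

/-- `ρ(w)_i`: the `i`-th row of the smallest partition whose Young diagram contains `D_w`. -/
noncomputable def rhoRow (w : Perm') (i : ℕ) : ℕ :=
  sSup {c : ℕ | ∃ r : ℕ, i ≤ r ∧ (r, c) ∈ RotheDiagram w}

/-! ### Tableaux (lists of rows), flagged SSYT, jeu de taquin -/

/-- Semistandard Young tableau of partition shape, presented as a list of rows. -/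
def IsSSYT (T : List (List ℕ)) : Prop :=
  (∀ row ∈ T, row ≠ []) ∧
  List.Chain' (fun r1 r2 : List ℕ => r2.length ≤ r1.length) T ∧
  (∀ row ∈ T, List.Chain' (· ≤ ·) row) ∧
  (∀ i j : ℕ, i + 1 < T.length → j < (T.getD (i + 1) []).length →
    (T.getD i []).getD j 0 < (T.getD (i + 1) []).getD j 0)

/-- `φ`-flagged semistandard Young tableaux of shape `λ`: the last entry of row `i`
is at most `φ_i`. -/
def IsFlaggedSSYT (lam phi : List ℕ) (T : List (List ℕ)) : Prop :=
  IsSSYT T ∧ T.map List.length = lam ∧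
  ∀ i : ℕ, i < T.length → (T.getD i []).getLastD 0 ≤ phi.getD i 0

/-- Semistandard Young tableaux with all entries at most `k` (`SSYT_k`). -/
def IsSSYTBounded (k : ℕ) (T : List (List ℕ)) : Prop :=
  IsSSYT T ∧ ∀ row ∈ T, ∀ x ∈ row, x ≤ k

/-- Set an entry of a tableau. -/
def setEntry (T : List (List ℕ)) (r c x : ℕ) : List (List ℕ) :=
  T.set r ((T.getD r []).set c x)

/-- One jeu de taquin slide with the empty tile at `(r, c)` (0-indexed):
swap the empty tile with the smaller of the entries to its right and below
(ties move down; missing boxes are `∞`); when both are missing, delete the cell. -/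
def jdtAux : ℕ → List (List ℕ) → ℕ → ℕ → List (List ℕ)
  | 0, T, _, _ => T
  | fuel + 1, T, r, c =>
    match (T.getD r [])[c + 1]?, (T.getD (r + 1) [])[c]? with
    | none, none => (T.set r ((T.getD r []).take c)).filter (fun row => !row.isEmpty)
    | some x, none => jdtAux fuel (setEntry T r c x) r (c + 1)
    | none, some y => jdtAux fuel (setEntry T r c y) (r + 1) c
    | some x, some y =>
      if x < y then jdtAux fuel (setEntry T r c x) r (c + 1)
      else jdtAux fuel (setEntry T r c y) (r + 1) c

/-- `jdt(T)`: remove the top-left box of `T` and rectify by jeu de taquin. -/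
def jdt (T : List (List ℕ)) : List (List ℕ) :=
  jdtAux ((T.map List.length).sum + 1) T 0 0

/-! ### Edelman–Greene column insertion and the recording tableau -/

/-- Edelman–Greene insertion of `x` into one increasing column `C`.
Returns the new column together with `none` (if `x` was appended, creating a new box)
or `some y` (where `y` is to be inserted into the next column). -/
def colIns (x : ℕ) (C : List ℕ) : List ℕ × Option ℕ :=
  if C.all (fun c => decide (c < x)) then (C ++ [x], none)
  else if x ∈ C ∧ (x + 1) ∈ C then (C, some (x + 1))
  else
    match C.find? (fun c => decide (x < c)) with
    | some ck => (C.map (fun c => if c = ck then x else c), some ck)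
    | none => (C, none)

/-- Edelman–Greene insertion of `x` into a tableau presented as a list of columns.
Returns the new columns and the (0-indexed) column containing the new box. -/
def egInsert : List (List ℕ) → ℕ → (List (List ℕ)) × ℕ
  | [], x => ([[x]], 0)
  | C :: rest, x =>
    match colIns x C with
    | (C', none) => (C' :: rest, 0)
    | (C', some y) =>
      let res := egInsert rest y
      (C' :: res.1, res.2 + 1)

/-- One step of the Edelman–Greene algorithm on the pair (insertion, recording) tableau:
insert `ra.2` into `P` and record `ra.1` in the new box of `Q`. -/
def egStep (PQ : (List (List ℕ)) × (List (List ℕ))) (ra : ℕ × ℕ) :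
    (List (List ℕ)) × (List (List ℕ)) :=
  let res := egInsert PQ.1 ra.2
  let Q := PQ.2
  let Q' := if res.2 < Q.length then Q.set res.2 (Q.getD res.2 [] ++ [ra.1]) else Q ++ [[ra.1]]
  (res.1, Q')

/-- A biword `(r_1,…,r_l ; a_1,…,a_l)`. -/
structure Biword where
  top : List ℕ
  bot : List ℕ

/-- The (insertion, recording) column tableaux of a biword under Edelman–Greene insertion. -/
def egPQ (P : Biword) : (List (List ℕ)) × (List (List ℕ)) :=
  (P.top.zip P.bot).foldl egStep ([], [])

/-- Convert a tableau presented as a list of columns into a list of rows. -/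
def colsToRows (cols : List (List ℕ)) : List (List ℕ) :=
  (List.range ((cols.map List.length).foldr max 0)).map
    (fun i => cols.filterMap (fun col => col[i]?))

/-- The Edelman–Greene recording tableau `Q̃` of a biword (as a list of rows). -/
def Qtilde (P : Biword) : List (List ℕ) := colsToRows (egPQ P).2

/-- The Edelman–Greene insertion tableau `P̃` of a biword (as a list of rows). -/
def Ptilde (P : Biword) : List (List ℕ) := colsToRows (egPQ P).1

/-- `(r ; a)` is a reduced compatible sequence for `w`: `a` is a reduced word for `w`,
`r` is weakly increasing, `r_i ≤ a_i`, and `r_i < r_{i+1}` whenever `a_i < a_{i+1}`.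
Membership in `PD(w)`. -/
def IsCompatible (w : Perm') (P : Biword) : Prop :=
  IsReducedWord w P.bot ∧
  List.Chain' (· ≤ ·) P.top ∧
  List.Forall₂ (· ≤ ·) P.top P.bot ∧
  (∀ m : ℕ, m + 1 < P.bot.length →
    P.bot.getD m 0 < P.bot.getD (m + 1) 0 → P.top.getD m 0 < P.top.getD (m + 1) 0)

/-! ### Bumpless pipe dreams -/

/-- The tiles: blank, vertical, horizontal, ⌐-elbow (S–E, "r"), ⌟-elbow (W–N, "j"),
crossing, and the bump tile (for almost bumpless pipe dreams). -/
inductive Tile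
  | blank | vert | horiz | se | nw | cross | bump
deriving DecidableEq

/-- A square grid of tiles; rows and columns are 1-indexed, rows increase downward. -/
structure Grid where
  n : ℕ
  tile : ℕ → ℕ → Tile

inductive Dir
  | north | east
deriving DecidableEq

def hasN : Tile → Bool
  | .vert => true | .nw => true | .cross => true | .bump => true | _ => false
def hasS : Tile → Bool
  | .vert => true | .se => true | .cross => true | .bump => true | _ => false
def hasE : Tile → Bool
  | .horiz => true | .se => true | .cross => true | .bump => true | _ => false
def hasW : Tile → Bool
  | .horiz => true | .nw => true | .cross => true | .bump => true | _ => false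

/-- The outgoing direction of a pipe through a tile, given the incoming heading
(`north` = entered through the south edge, `east` = entered through the west edge). -/
def outDir : Tile → Dir → Option Dir
  | .vert, .north => some .north
  | .cross, .north => some .north
  | .se, .north => some .east
  | .bump, .north => some .east
  | .horiz, .east => some .east
  | .cross, .east => some .east
  | .nw, .east => some .north
  | .bump, .east => some .north
  | _, _ => none

/-- Trace a pipe; returns the row in which it exits through the east edge of the grid. -/
def traceAux (g : Grid) : ℕ → ℕ → ℕ → Dir → Option ℕ
  | 0, _, _, _ => none
  | fuel + 1, x, y, d =>
    match outDir (g.tile x y) d with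
    | none => none
    | some Dir.north => if x ≤ 1 then none else traceAux g fuel (x - 1) y Dir.north
    | some Dir.east => if g.n ≤ y then some x else traceAux g fuel x (y + 1) Dir.east

/-- The exit row of the pipe entering at the bottom of column `c`. -/
def exitRow (g : Grid) (c : ℕ) : Option ℕ := traceAux g (2 * g.n + 2) g.n c Dir.north

/-- The list of states `(row, column, heading)` visited by a pipe. -/
def pathAux (g : Grid) : ℕ → ℕ → ℕ → Dir → List (ℕ × ℕ × Dir)
  | 0, _, _, _ => []
  | fuel + 1, x, y, d =>
    (x, y, d) ::
      (match outDir (g.tile x y) d with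
       | none => []
       | some Dir.north => if x ≤ 1 then [] else pathAux g fuel (x - 1) y Dir.north
       | some Dir.east => if g.n ≤ y then [] else pathAux g fuel x (y + 1) Dir.east)

/-- The path of the pipe entering at the bottom of column `c`. -/
def pipePath (g : Grid) (c : ℕ) : List (ℕ × ℕ × Dir) := pathAux g (2 * g.n + 2) g.n c Dir.north

/-- Pipe `c` passes through position `z`. -/
def passes (g : Grid) (c : ℕ) (z : ℕ × ℕ) : Prop :=
  ∃ d : Dir, (z.1, z.2, d) ∈ pipePath g c

def InGrid (g : Grid) (i j : ℕ) : Prop := 1 ≤ i ∧ i ≤ g.n ∧ 1 ≤ j ∧ j ≤ g.n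

/-- A (reduced) bumpless pipe dream: tiles match along edges; pipes enter along the
bottom and exit along the right; no bump tiles; no two pipes cross more than once.
(Tiles outside the grid are normalized to `horiz`.) -/
def IsBPD (g : Grid) : Prop :=
  1 ≤ g.n ∧
  (∀ i j, ¬ InGrid g i j → g.tile i j = Tile.horiz) ∧
  (∀ i j, InGrid g i j → g.tile i j ≠ Tile.bump) ∧
  (∀ i j, 1 ≤ i → i < g.n → 1 ≤ j → j ≤ g.n → hasS (g.tile i j) = hasN (g.tile (i + 1) j)) ∧
  (∀ i j, 1 ≤ i → i ≤ g.n → 1 ≤ j → j < g.n → hasE (g.tile i j) = hasW (g.tile i (j + 1))) ∧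
  (∀ j, 1 ≤ j → j ≤ g.n → hasN (g.tile 1 j) = false) ∧
  (∀ j, 1 ≤ j → j ≤ g.n → hasS (g.tile g.n j) = true) ∧
  (∀ i, 1 ≤ i → i ≤ g.n → hasW (g.tile i 1) = false) ∧
  (∀ i, 1 ≤ i → i ≤ g.n → hasE (g.tile i g.n) = true) ∧
  (∀ c c', 1 ≤ c → c ≤ g.n → 1 ≤ c' → c' ≤ g.n → c ≠ c' →
    Set.Subsingleton {z : ℕ × ℕ | g.tile z.1 z.2 = Tile.cross ∧ passes g c z ∧ passes g c' z})

/-- `g ∈ BPD(w)`: `g` is a bumpless pipe dream whose permutation is `w`, i.e. the pipe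
entering at the bottom of column `c` exits to the right in row `w⁻¹(c)`. -/
def MemBPD (w : Perm') (g : Grid) : Prop :=
  IsBPD g ∧ w 0 = 0 ∧ (∀ k, g.n < k → w k = k) ∧
  (∀ c, 1 ≤ c → c ≤ g.n → exitRow g c = some (w.symm c))

/-! ### Weigandt's map γ -/

/-- The blank tiles on the diagonal `{(i,j) : j - i = d}`, from northwest to southeast. -/
def blanksOnDiag (g : Grid) (d : ℤ) : List (ℕ × ℕ) :=
  (List.range' 1 g.n).filterMap (fun (i : ℕ) =>
    let jz : ℤ := (i : ℤ) + d
    if 1 ≤ jz ∧ jz ≤ (g.n : ℤ) then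
      (if g.tile i jz.toNat = Tile.blank then some (i, jz.toNat) else none)
    else none)

/-- The number of pipes passing above position `(i,j)`: tiles above it in column `j`
in which a pipe travels eastward. -/
def pipesAbove (g : Grid) (i j : ℕ) : ℕ :=
  ((List.range' 1 g.n).filter (fun x => decide (x < i) && hasE (g.tile x j))).length

/-- Weigandt's map `γ` (for vexillary permutations): fill each blank tile with the number
of pipes above it, slide the filled tiles northwest along their diagonals into the Young
diagram of `lam`, and add `i` to every entry in row `i`. -/
def weigandt (g : Grid) (lam : List ℕ) : List (List ℕ) :=
  (List.range lam.length).map (fun (r0 : ℕ) =>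
    (List.range (lam.getD r0 0)).map (fun (c0 : ℕ) =>
      let r : ℕ := r0 + 1
      let c : ℕ := c0 + 1
      let p := (blanksOnDiag g ((c : ℤ) - (r : ℤ))).getD (min r c - 1) (0, 0)
      pipesAbove g p.1 p.2 + r))

/-! ### The Gao–Huang operator ∇, pop, and the bijection φ -/

/-- Backward tracing: enter tile `(x,y)` through its north edge (`viaN = true`) or its
east edge (`viaN = false`) and follow the pipe backwards; returns the bottom column
at which the pipe enters the grid. -/
def backAux (g : Grid) : ℕ → ℕ → ℕ → Bool → Option ℕ
  | 0, _, _, _ => none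
  | fuel + 1, x, y, viaN =>
    if g.n < x then none
    else if viaN then
      match g.tile x y with
      | .vert | .cross => if x = g.n then some y else backAux g fuel (x + 1) y true
      | .nw | .bump => backAux g fuel x (y - 1) false
      | _ => none
    else
      match g.tile x y with
      | .horiz | .cross => backAux g fuel x (y - 1) false
      | .se | .bump => if x = g.n then some y else backAux g fuel (x + 1) y true
      | _ => none

/-- The label of the pipe passing through `(x,y)` entering from the south. -/
def pipeFromS (g : Grid) (x y : ℕ) : Option ℕ :=
  if x = g.n then some y else backAux g (2 * g.n + 2) (x + 1) y true

/-- Move the mark east to the rightmost blank tile in its contiguous block of blanks. -/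
def slideEast (g : Grid) (i j : ℕ) : ℕ :=
  ((List.range' j (g.n + 1)).takeWhile (fun y => g.tile i y == Tile.blank)).getLastD j

/-- Tile rewrite for the undroop of the pipe `p` (from `(i', j+1)` into `(i, j)`)
performed in one iteration of the Gao–Huang procedure; the `(i', j+1)` case `cross → se`
is the final uncrossing step. -/
def nablaUndroop (T : ℕ → ℕ → Tile) (i i' j : ℕ) : ℕ → ℕ → Tile := fun x y =>
  let t := T x y
  if x = i ∧ y = j then (match t with | Tile.blank => Tile.se | _ => t)
  else if x = i' ∧ y = j then
    (match t with | Tile.se => Tile.vert | Tile.horiz => Tile.nw | _ => t)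
  else if x = i ∧ y = j + 1 then
    (match t with | Tile.se => Tile.horiz | Tile.vert => Tile.nw | _ => t)
  else if x = i' ∧ y = j + 1 then
    (match t with | Tile.nw => Tile.blank | Tile.cross => Tile.se | _ => t)
  else if y = j ∧ i < x ∧ x < i' then
    (match t with | Tile.blank => Tile.vert | Tile.horiz => Tile.cross | _ => t)
  else if y = j + 1 ∧ i < x ∧ x < i' then
    (match t with | Tile.vert => Tile.blank | Tile.cross => Tile.horiz | _ => t)
  else t

/-- Tile rewrite for the droop (from `(k, j)` into `(k', j+1)`) of a pipe `q` having both
a ⌐-turn and a ⌟-turn in column `j`, performed after the undroop of `p`. -/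
def nablaQDroop (T : ℕ → ℕ → Tile) (k k' j : ℕ) : ℕ → ℕ → Tile := fun x y =>
  let t := T x y
  if x = k ∧ y = j then (match t with | Tile.se => Tile.vert | _ => t)
  else if x = k' ∧ y = j then (match t with | Tile.nw => Tile.cross | _ => t)
  else if x = k ∧ y = j + 1 then (match t with | Tile.horiz => Tile.se | _ => t)
  else if x = k' ∧ y = j + 1 then (match t with | Tile.blank => Tile.nw | _ => t)
  else if y = j + 1 ∧ k < x ∧ x < k' then
    (match t with | Tile.blank => Tile.vert | Tile.horiz => Tile.cross | _ => t)
  else t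

/-- The ⌐/⌟ elbow pairs `(k, k')` of pipes in column `j` strictly between rows `i` and `i'`. -/
def qPairs (g : Grid) (i i' j : ℕ) : List (ℕ × ℕ) :=
  (List.range' 1 g.n).filterMap (fun k =>
    if i < k ∧ k < i' ∧ g.tile k j = Tile.se then
      match (List.range' 1 g.n).find?
          (fun k' => decide (k < k' ∧ k' < i' ∧ g.tile k' j = Tile.nw)) with
      | some k' => some (k, k')
      | none => none
    else none)

/-- One iteration of the marked-tile procedure on the rectangle with corners
`(i, j)` and `(i', j+1)`: undroop `p`, then droop the intersecting pipes. -/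
def nablaIter (g : Grid) (i i' j : ℕ) : Grid :=
  ⟨g.n, (qPairs g i i' j).foldl (fun T kk => nablaQDroop T kk.1 kk.2 j)
    (nablaUndroop g.tile i i' j)⟩

/-- The marked-tile loop of the Gao–Huang procedure; returns `(∇B, a)`. -/
def nablaLoop (g : Grid) : ℕ → ℕ × ℕ → Grid × ℕ
  | 0, _ => (g, 0)
  | fuel + 1, (i, j0) =>
    let j := slideEast g i j0
    match pipeFromS g i (j + 1) with
    | none => (g, 0)
    | some p =>
      if p = j + 1 then
        match (List.range' 1 g.n).find? (fun x =>
            decide (i < x) && (g.tile x (j + 1) == Tile.cross) &&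
            (backAux g (2 * g.n + 2) x (j + 1) false == some j)) with
        | some i' => (nablaIter g i i' j, j)
        | none => (g, 0)
      else
        match (List.range' 1 g.n).find? (fun x =>
            decide (i < x) && (g.tile x (j + 1) == Tile.nw)) with
        | some i' => nablaLoop (nablaIter g i i' j) fuel (i', j + 1)
        | none => (g, 0)

/-- The Gao–Huang procedure: returns `(∇B, (r, a))` where `pop(B) = (r, a)`. -/
def nablaPop (g : Grid) : Grid × ℕ × ℕ :=
  match (List.range' 1 g.n).find?
      (fun i => (List.range' 1 g.n).any (fun j => g.tile i j == Tile.blank)) with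
  | none => (g, 0, 0)
  | some r =>
    let j0 := ((List.range' 1 g.n).filter (fun j => g.tile r j == Tile.blank)).getLastD 0
    let res := nablaLoop g (g.n + 1) (r, j0)
    (res.1, r, res.2)

/-- The Gao–Huang operator `∇`. -/
def nabla (g : Grid) : Grid := (nablaPop g).1

/-- `pop(B) = (r, a)`. -/
def pop (g : Grid) : ℕ × ℕ := (nablaPop g).2

/-- The number of crossing tiles of `g` (which equals `ℓ(w)` for `g ∈ BPD(w)`). -/
def crossCount (g : Grid) : ℕ :=
  ((List.range' 1 g.n).map (fun i =>
    ((List.range' 1 g.n).filter (fun j => g.tile i j == Tile.cross)).length)).sum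

def phiAux : ℕ → Grid → List (ℕ × ℕ)
  | 0, _ => []
  | l + 1, g => pop g :: phiAux l (nabla g)

/-- The Gao–Huang bijection `φ : BPD(w) → PD(w)`,
`φ(B) = (r_1,…,r_l ; a_1,…,a_l)` with `(r_i, a_i) = pop(∇^{i-1} B)`. -/
def phi (g : Grid) : Biword :=
  ⟨(phiAux (crossCount g) g).map Prod.fst, (phiAux (crossCount g) g).map Prod.snd⟩

/-! ### Little bumps (relational) -/

/-- The reflection labelling the crossing at position `m` (0-indexed) of the word `a`:
deleting the letter at position `m` from `a` yields a word for `wordProd a * crossingRefl a m`.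
The wires `i` and `j` cross at position `m` iff `crossingRefl a m = t_{ij}`. -/
def crossingRefl (a : List ℕ) (m : ℕ) : Perm' :=
  (wordProd (a.drop (m + 1)))⁻¹ * sT (a.getD m 0) * wordProd (a.drop (m + 1))

/-- `a` is a reduced word (for its own product). -/
def IsReducedSelf (a : List ℕ) : Prop := IsReducedWord (wordProd a) a

/-- Increment the entry of `a` at position `m`. -/
def incrAt (a : List ℕ) (m : ℕ) : List ℕ := a.set m (a.getD m 0 + 1)

/-- The (upward) Little bump `L_{ij}` as a relation on biwords: starting at the position
`m_1` where wires `i` and `j` cross, repeatedly increment the current entry; stop when the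
bottom word becomes reduced, and otherwise move to the unique other position whose crossing
involves the same pair of wires. -/
def LittleBumpRel (i j : ℕ) (P P' : Biword) : Prop :=
  P'.top = P.top ∧
  ∃ ms : List ℕ, ∃ ws : List (List ℕ),
    ms ≠ [] ∧
    ws.length = ms.length + 1 ∧
    ws.getD 0 [] = P.bot ∧
    ws.getLastD [] = P'.bot ∧
    (∀ t : ℕ, t < ms.length → ws.getD (t + 1) [] = incrAt (ws.getD t []) (ms.getD t 0)) ∧
    crossingRefl P.bot (ms.getD 0 0) = tT i j ∧
    (∀ t : ℕ, t + 1 < ms.length →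
      ¬ IsReducedSelf (ws.getD (t + 1) []) ∧
      ms.getD (t + 1) 0 ≠ ms.getD t 0 ∧
      crossingRefl (ws.getD (t + 1) []) (ms.getD t 0)
        = crossingRefl (ws.getD (t + 1) []) (ms.getD (t + 1) 0)) ∧
    IsReducedSelf P'.bot

/-! ### Huang bumps -/

/-- Least offset `t ≥ 1` satisfying `p` (searched up to `bound + 1`). -/
def leastOff (p : ℕ → Bool) (bound : ℕ) : ℕ :=
  ((List.range' 1 (bound + 1)).filter p).headD 1

/-- The southeast corner `(x + k, y + l)` of the min-droop at `(x, y)`: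
`k, l ≥ 1` minimal with `(x+k, y)` and `(x, y+l)` not crossing tiles. -/
def minDroopCorner (g : Grid) (x y : ℕ) : ℕ × ℕ :=
  (x + leastOff (fun k => !(g.tile (x + k) y == Tile.cross)) g.n,
   y + leastOff (fun l => !(g.tile x (y + l) == Tile.cross)) g.n)

/-- The min-droop at `(x, y)`: droop the ⌐-turn at `(x, y)` into `(x+k, y+l)`. -/
def minDroopT (g : Grid) (x y : ℕ) : Grid :=
  let k := leastOff (fun k => !(g.tile (x + k) y == Tile.cross)) g.n
  let l := leastOff (fun l => !(g.tile x (y + l) == Tile.cross)) g.n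
  ⟨g.n, fun a b =>
    let t := g.tile a b
    if a = x ∧ b = y then
      (match t with | Tile.se => Tile.blank | Tile.bump => Tile.nw | _ => t)
    else if a = x + k ∧ b = y then (match t with | Tile.vert => Tile.se | _ => t)
    else if a = x ∧ b = y + l then
      (match t with | Tile.horiz => Tile.se | Tile.nw => Tile.vert | _ => t)
    else if a = x + k ∧ b = y + l then
      (match t with | Tile.blank => Tile.nw | Tile.se => Tile.bump | _ => t)
    else if b = y ∧ x < a ∧ a < x + k then
      (match t with | Tile.cross => Tile.horiz | Tile.vert => Tile.blank | _ => t)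
    else if a = x ∧ y < b ∧ b < y + l then
      (match t with | Tile.cross => Tile.vert | Tile.horiz => Tile.blank | _ => t)
    else if a = x + k ∧ y < b ∧ b < y + l then
      (match t with | Tile.blank => Tile.horiz | Tile.vert => Tile.cross | _ => t)
    else if b = y + l ∧ x < a ∧ a < x + k then
      (match t with | Tile.blank => Tile.vert | Tile.horiz => Tile.cross | _ => t)
    else t⟩

/-- Replace a single tile. -/
def setTile (g : Grid) (x y : ℕ) (t : Tile) : Grid :=
  ⟨g.n, fun a b => if a = x ∧ b = y then t else g.tile a b⟩

/-- Pipe `c` passes through `(x, y)` (Boolean). -/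
def onPath (g : Grid) (c : ℕ) (x y : ℕ) : Bool :=
  decide ((x, y, Dir.north) ∈ pipePath g c) || decide ((x, y, Dir.east) ∈ pipePath g c)

/-- The position of the crossing tile where pipes `c` and `c'` cross, if any. -/
def findCrossing (g : Grid) (c c' : ℕ) : Option (ℕ × ℕ) :=
  (pipePath g c).findSome? (fun s =>
    if (g.tile s.1 s.2.1 == Tile.cross) && onPath g c' s.1 s.2.1 then some (s.1, s.2.1)
    else none)

/-- The column of the ⌐-turn of pipe `c` in row `row`, if any. -/
def seTurnCol (g : Grid) (c row : ℕ) : Option ℕ :=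
  (pipePath g c).findSome? (fun s =>
    if s.1 = row ∧ s.2.2 = Dir.north ∧
        (g.tile s.1 s.2.1 = Tile.se ∨ g.tile s.1 s.2.1 = Tile.bump) then some s.2.1
    else none)

/-- The iteration of the Huang bump: min-droops and cross-bump-swaps until a bump tile
is turned into a crossing tile. -/
def huangLoop (iPipe : ℕ) : ℕ → Grid → ℕ × ℕ → Grid
  | 0, g, _ => g
  | fuel + 1, g, (x, y) =>
    let c := minDroopCorner g x y
    let g1 := minDroopT g x y
    match g1.tile c.1 c.2 with
    | Tile.nw =>
      match seTurnCol g1 iPipe c.1 with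
      | some col => huangLoop iPipe fuel g1 (c.1, col)
      | none => g1
    | Tile.bump =>
      match backAux g1 (2 * g1.n + 2) c.1 c.2 false with
      | some q =>
        match findCrossing g1 iPipe q with
        | some z =>
          huangLoop iPipe fuel (setTile (setTile g1 c.1 c.2 Tile.cross) z.1 z.2 Tile.bump) z
        | none => setTile g1 c.1 c.2 Tile.cross
      | none => g1
    | _ => g1

/-- Fuel exceeding the number of states of the procedure. -/
def huangFuel (g : Grid) : ℕ := 7 ^ (g.n * g.n) * (g.n * g.n) + 2

/-- The Huang bump `H_{ij}`: replace the crossing of pipes `i` and `j` by a bump tile,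
then repeatedly min-droop and cross-bump-swap until a new crossing tile is created. -/
def huang (i j : ℕ) (g : Grid) : Grid :=
  match findCrossing g i j with
  | some z => huangLoop i (huangFuel g) (setTile g z.1 z.2 Tile.bump) z
  | none => g



/-- `At g p T x y d`: at time `T` pipe `p` of `g` enters the cell `(x, y)` with heading `d`. -/
inductive At (g : Grid) (p : ℕ) : ℕ → ℕ → ℕ → Dir → Prop
  | start : At g p p g.n p Dir.north
  | north {T x y : ℕ} {d : Dir} : At g p T (x + 1) y d →
      outDir (g.tile (x + 1) y) d = some Dir.north → 1 ≤ x → At g p (T + 1) x y Dir.north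
  | east {T x y : ℕ} {d : Dir} : At g p T x y d →
      outDir (g.tile x y) d = some Dir.east → y < g.n → At g p (T + 1) x (y + 1) Dir.east

theorem At.inv {g : Grid} {p T x y : ℕ} {d : Dir} (h : At g p T x y d) :
    p ≤ T ∧ T + x = y + g.n ∧ x ≤ g.n ∧ p ≤ y := by
  induction h with
  | start => omega
  | north _ _ _ ih => omega
  | east _ _ _ ih => omega

theorem At.inv2 {g : Grid} {p T x y : ℕ} {d : Dir} (h : At g p T x y d)
    (hp : 1 ≤ p) (hpn : p ≤ g.n) : 1 ≤ x ∧ y ≤ g.n := by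
  induction h with
  | start => omega
  | north _ _ _ ih => omega
  | east _ _ _ ih => omega

theorem At.cases_succ {g : Grid} {p T x y : ℕ} {d : Dir} (h : At g p (T + 1) x y d)
    (hp : p ≤ T) :
    (d = Dir.north ∧ 1 ≤ x ∧ ∃ d', At g p T (x + 1) y d' ∧
        outDir (g.tile (x + 1) y) d' = some Dir.north) ∨
    (d = Dir.east ∧ ∃ y' d', y = y' + 1 ∧ y' < g.n ∧ At g p T x y' d' ∧
        outDir (g.tile x y') d' = some Dir.east) := by
  generalize hT : T + 1 = T' at h
  cases h with
  | start => omega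
  | north h1 h2 h3 =>
    obtain rfl := Nat.succ.inj hT
    exact Or.inl ⟨rfl, h3, _, h1, h2⟩
  | east h1 h2 h3 =>
    obtain rfl := Nat.succ.inj hT
    exact Or.inr ⟨rfl, _, _, rfl, h3, h1, h2⟩

theorem At.at_start {g : Grid} {p x y : ℕ} {d : Dir} (h : At g p p x y d) :
    x = g.n ∧ y = p ∧ d = Dir.north := by
  generalize hT : p = T at h
  cases h with
  | start => exact ⟨rfl, rfl, rfl⟩
  | north h1 h2 h3 => have := h1.inv; omega
  | east h1 h2 h3 => have := h1.inv; omega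

theorem At.det {g : Grid} {p T x y : ℕ} {d : Dir} (h : At g p T x y d) :
    ∀ {x' y' : ℕ} {d' : Dir}, At g p T x' y' d' → x = x' ∧ y = y' ∧ d = d' := by
  induction h with
  | start => intro x' y' d' h'; have := h'.at_start; aesop
  | north h1 h2 h3 ih =>
    intro x' y' d' h'
    rcases h'.cases_succ h1.inv.1 with ⟨rfl, _, d1, ha, hb⟩ | ⟨rfl, y1, d1, rfl, _, ha, hb⟩
    · have := ih ha; refine ⟨by omega, by omega, rfl⟩
    · obtain ⟨e1, e2, e3⟩ := ih ha
      subst e1; subst e2; subst e3; rw [h2] at hb; simp at hb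
  | east h1 h2 h3 ih =>
    intro x' y' d' h'
    rcases h'.cases_succ h1.inv.1 with ⟨rfl, _, d1, ha, hb⟩ | ⟨rfl, y1, d1, rfl, _, ha, hb⟩
    · obtain ⟨e1, e2, e3⟩ := ih ha
      subst e1; subst e2; subst e3; rw [h2] at hb; simp at hb
    · have := ih ha; refine ⟨by omega, by omega, rfl⟩

theorem At.exists_le {g : Grid} {p T x y : ℕ} {d : Dir} (h : At g p T x y d) :
    ∀ T', p ≤ T' → T' ≤ T → ∃ x' y' d', At g p T' x' y' d' ∧ x ≤ x' ∧ y' ≤ y := by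
  induction h with
  | start => intro T' h1 h2; obtain rfl : T' = p := by omega
             exact ⟨_, _, _, At.start, le_refl _, le_refl _⟩
  | @north T x y d h1 h2 h3 ih =>
    intro T' h4 h5
    by_cases h6 : T' = T + 1
    · subst h6; exact ⟨_, _, _, At.north h1 h2 h3, le_refl _, le_refl _⟩
    · obtain ⟨x', y', d', ha, hb, hc⟩ := ih T' h4 (by omega)
      exact ⟨x', y', d', ha, by omega, hc⟩
  | @east T x y d h1 h2 h3 ih =>
    intro T' h4 h5
    by_cases h6 : T' = T + 1
    · subst h6; exact ⟨_, _, _, At.east h1 h2 h3, le_refl _, le_refl _⟩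
    · obtain ⟨x', y', d', ha, hb, hc⟩ := ih T' h4 (by omega)
      exact ⟨x', y', d', ha, by omega, by omega⟩

theorem At.mono {g : Grid} {p T x y : ℕ} {d : Dir} (h : At g p T x y d)
    {T' x' y' : ℕ} {d' : Dir} (h' : At g p T' x' y' d') (hT : T' ≤ T) : x ≤ x' ∧ y' ≤ y := by
  obtain ⟨x1, y1, d1, ha, hb, hc⟩ := h.exists_le T' h'.inv.1 hT
  obtain ⟨e1, e2, e3⟩ := ha.det h'
  omega

theorem At.row_n {g : Grid} {p T y : ℕ} {d : Dir} (h : At g p T g.n y d) (hy : y ≠ p) :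
    d = Dir.east := by
  generalize hx : g.n = x at h
  cases h with
  | start => exact absurd rfl hy
  | north h1 h2 h3 => have := h1.inv; omega
  | east h1 h2 h3 => rfl

theorem outDir_inj {t : Tile} {d d' e : Dir} (h : outDir t d = some e)
    (h' : outDir t d' = some e) : d = d' := by
  cases t <;> cases d <;> cases d' <;> cases e <;> simp_all [outDir]

theorem At.inj {g : Grid} {p T x y : ℕ} {d : Dir} (h : At g p T x y d) :
    ∀ {p' : ℕ}, At g p' T x y d → p = p' := by
  induction h with
  | start =>
    intro p' h'
    by_contra hne
    have := h'.row_n hne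
    simp at this
  | @north T x y d h1 h2 h3 ih =>
    intro p' h'
    have hp := h1.inv
    have hp' := h'.inv
    rcases h'.cases_succ (by omega) with ⟨_, _, d1, ha, hb⟩ | ⟨hh, _⟩
    · obtain rfl := outDir_inj h2 hb
      exact ih ha
    · simp at hh
  | @east T x y d h1 h2 h3 ih =>
    intro p' h'
    have hp := h1.inv
    have hp' := h'.inv
    by_cases hq : p' ≤ T
    · rcases h'.cases_succ hq with ⟨hh, _⟩ | ⟨_, y1, d1, e1, _, ha, hb⟩
      · simp at hh
      · obtain rfl : y = y1 := by omega
        obtain rfl := outDir_inj h2 hb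
        exact ih ha
    · obtain rfl : p' = T + 1 := by omega
      have := h'.at_start
      simp at this

/-- Pipe `p` leaves the grid in row `r`. -/
def Exits (g : Grid) (p r : ℕ) : Prop :=
  ∃ T d, At g p T r g.n d ∧ outDir (g.tile r g.n) d = some Dir.east

theorem exits_of_traceAux {g : Grid} {p : ℕ} (hp : 1 ≤ p) (hpn : p ≤ g.n) :
    ∀ (fuel : ℕ) {T x y r : ℕ} {d : Dir}, At g p T x y d →
      traceAux g fuel x y d = some r → Exits g p r := by
  intro fuel
  induction fuel with
  | zero => intro T x y r d h ht; simp [traceAux] at ht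
  | succ f ih =>
    intro T x y r d h ht
    have hi := h.inv2 hp hpn
    rw [traceAux] at ht
    cases ho : outDir (g.tile x y) d with
    | none => simp [ho] at ht
    | some e =>
      cases e with
      | north =>
        simp only [ho] at ht
        split_ifs at ht with hx
        obtain ⟨x', rfl⟩ : ∃ x', x = x' + 1 := ⟨x - 1, by omega⟩
        exact ih (At.north h ho (by omega)) (by simpa using ht)
      | east =>
        simp only [ho] at ht
        split_ifs at ht with hy
        · obtain rfl : y = g.n := by omega
          obtain rfl : x = r := by simpa using ht
          exact ⟨T, d, h, ho⟩
        · exact ih (At.east h ho (by omega)) ht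

theorem Exits.max {g : Grid} {p r T d} (h : At g p T r g.n d)
    (ho : outDir (g.tile r g.n) d = some Dir.east) {T' x y : ℕ} {d' : Dir}
    (h' : At g p T' x y d') : T' ≤ T := by
  by_contra hlt
  have := h.inv
  obtain ⟨x1, y1, d1, ha, _⟩ := h'.exists_le (T + 1) (by omega) (by omega)
  rcases ha.cases_succ h.inv.1 with ⟨rfl, _, d1, hb, hc⟩ | ⟨rfl, y1, d1, rfl, hz, hb, hc⟩
  · obtain ⟨e1, e2, e3⟩ := hb.det h
    subst e1; subst e2; subst e3; rw [ho] at hc; simp at hc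
  · have := hb.det h; omega

theorem Exits.unique {g : Grid} {p r r' : ℕ} (h : Exits g p r) (h' : Exits g p r') : r = r' := by
  obtain ⟨T, d, h1, h2⟩ := h
  obtain ⟨T', d', h1', h2'⟩ := h'
  have a := Exits.max h1 h2 h1'
  have b := Exits.max h1' h2' h1
  obtain rfl : T = T' := by omega
  exact (h1.det h1').1

theorem At.of_mem_pathAux {g : Grid} {p : ℕ} (hp : 1 ≤ p) (hpn : p ≤ g.n) :
    ∀ (fuel : ℕ) {T x y : ℕ} {d : Dir} {s : ℕ × ℕ × Dir}, At g p T x y d →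
      s ∈ pathAux g fuel x y d → ∃ T', At g p T' s.1 s.2.1 s.2.2 := by
  intro fuel
  induction fuel with
  | zero => intro T x y d s h ht; simp [pathAux] at ht
  | succ f ih =>
    intro T x y d s h ht
    have hi := h.inv2 hp hpn
    rw [pathAux] at ht
    rcases List.mem_cons.1 ht with rfl | ht
    · exact ⟨T, h⟩
    cases ho : outDir (g.tile x y) d with
    | none => simp [ho] at ht
    | some e =>
      cases e with
      | north =>
        simp only [ho] at ht
        split_ifs at ht with hx
        · simp at ht
        obtain ⟨x', rfl⟩ : ∃ x', x = x' + 1 := ⟨x - 1, by omega⟩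
        exact ih (At.north h ho (by omega)) (by simpa using ht)
      | east =>
        simp only [ho] at ht
        split_ifs at ht with hy
        · simp at ht
        · exact ih (At.east h ho (by omega)) ht

theorem At.of_mem {g : Grid} {p : ℕ} (hp : 1 ≤ p) (hpn : p ≤ g.n) {s : ℕ × ℕ × Dir}
    (h : s ∈ pipePath g p) : ∃ T', At g p T' s.1 s.2.1 s.2.2 :=
  At.of_mem_pathAux hp hpn _ At.start h

theorem At.subset {g : Grid} {p T x y : ℕ} {d : Dir} (h : At g p T x y d) (F : ℕ) :
    T - p ≤ F → pathAux g (F - (T - p)) x y d ⊆ pathAux g F g.n p Dir.north := by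
  induction h with
  | start => intro _; simp
  | @north T x y d h1 h2 h3 ih =>
    intro hF
    have hi := h1.inv
    refine List.Subset.trans ?_ (ih (by omega))
    obtain ⟨f, hf⟩ : ∃ f, F - (T - p) = f + 1 := ⟨F - (T - p) - 1, by omega⟩
    have hf' : F - (T + 1 - p) = f := by omega
    rw [hf, hf', pathAux, h2]
    simp only [Nat.add_sub_cancel]
    rw [if_neg (by omega)]
    exact List.subset_cons_self _ _
  | @east T x y d h1 h2 h3 ih =>
    intro hF
    have hi := h1.inv
    refine List.Subset.trans ?_ (ih (by omega))
    obtain ⟨f, hf⟩ : ∃ f, F - (T - p) = f + 1 := ⟨F - (T - p) - 1, by omega⟩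
    have hf' : F - (T + 1 - p) = f := by omega
    rw [hf, hf', pathAux, h2]
    simp only
    rw [if_neg (by omega)]
    exact List.subset_cons_self _ _

theorem At.mem {g : Grid} {p T x y : ℕ} {d : Dir} (h : At g p T x y d)
    (hp : 1 ≤ p) (hpn : p ≤ g.n) : (x, y, d) ∈ pipePath g p := by
  have h1 := h.inv
  have h2 := h.inv2 hp hpn
  apply h.subset (2 * g.n + 2) (by omega)
  obtain ⟨f, hf⟩ : ∃ f, 2 * g.n + 2 - (T - p) = f + 1 := ⟨2 * g.n + 2 - (T - p) - 1, by omega⟩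
  rw [hf, pathAux]
  exact List.mem_cons_self

/-! ### Valid headings and meetings in a bumpless pipe dream -/

/-- A heading that matches the tile. -/
def Valid (t : Tile) : Dir → Prop
  | .north => hasS t = true
  | .east => hasW t = true

theorem At.valid {g : Grid} (hg : IsBPD g) {p T x y : ℕ} {d : Dir} (h : At g p T x y d)
    (hp : 1 ≤ p) (hpn : p ≤ g.n) : Valid (g.tile x y) d := by
  obtain ⟨h1, h2, h3, h4, h5, h6, h7, h8, h9, h10⟩ := hg
  induction h with
  | start => exact h7 p hp hpn
  | @north T x y d ha hb hc ih =>
    have hi := ha.inv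
    have hi2 := ha.inv2 hp hpn
    have := h4 x y hc (by omega) (by omega) (by omega)
    show hasS _ = true
    rw [this]
    revert hb; cases g.tile (x + 1) y <;> cases d <;> simp [outDir, hasN]
  | @east T x y d ha hb hc ih =>
    have hi := ha.inv
    have hi2 := ha.inv2 hp hpn
    have := h5 x y (by omega) (by omega) (by omega) hc
    show hasW _ = true
    rw [← this]
    revert hb; cases g.tile x y <;> cases d <;> simp [outDir, hasE]

theorem At.inGrid {g : Grid} {p T x y : ℕ} {d : Dir} (h : At g p T x y d)
    (hp : 1 ≤ p) (hpn : p ≤ g.n) : InGrid g x y := by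
  have := h.inv; have := h.inv2 hp hpn
  exact ⟨by omega, by omega, by omega, by omega⟩

theorem meet_cross {g : Grid} (hg : IsBPD g) {p p' T x y : ℕ} {d d' : Dir}
    (h : At g p T x y d) (h' : At g p' T x y d') (hne : p ≠ p')
    (hp : 1 ≤ p) (hpn : p ≤ g.n) (hp' : 1 ≤ p') (hpn' : p' ≤ g.n) :
    g.tile x y = Tile.cross := by
  have hd : d ≠ d' := by rintro rfl; exact hne (h.inj h')
  have v1 := h.valid hg hp hpn
  have v2 := h'.valid hg hp' hpn'
  have nb := hg.2.2.1 x y (h.inGrid hp hpn)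
  revert hd v1 v2 nb
  cases g.tile x y <;> cases d <;> cases d' <;> simp [Valid, hasS, hasW]

theorem meet_unique {g : Grid} (hg : IsBPD g) {p p' T x y T' x' y' : ℕ} {d d' e e' : Dir}
    (h : At g p T x y d) (h' : At g p' T x y d') (k : At g p T' x' y' e)
    (k' : At g p' T' x' y' e') (hne : p ≠ p')
    (hp : 1 ≤ p) (hpn : p ≤ g.n) (hp' : 1 ≤ p') (hpn' : p' ≤ g.n) : T = T' := by
  have c1 := meet_cross hg h h' hne hp hpn hp' hpn'
  have c2 := meet_cross hg k k' hne hp hpn hp' hpn'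
  have hS := hg.2.2.2.2.2.2.2.2.2 p p' hp hpn hp' hpn' hne
  have m1 : ((x, y) : ℕ × ℕ) ∈ {z : ℕ × ℕ | g.tile z.1 z.2 = Tile.cross ∧ passes g p z ∧
      passes g p' z} := ⟨c1, ⟨d, h.mem hp hpn⟩, ⟨d', h'.mem hp' hpn'⟩⟩
  have m2 : ((x', y') : ℕ × ℕ) ∈ {z : ℕ × ℕ | g.tile z.1 z.2 = Tile.cross ∧ passes g p z ∧
      passes g p' z} := ⟨c2, ⟨e, k.mem hp hpn⟩, ⟨e', k'.mem hp' hpn'⟩⟩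
  have := hS m1 m2
  have a := h.inv
  have b := k.inv
  simp only [Prod.mk.injEq] at this
  omega

theorem step_order {g : Grid} {p p' T x y x' y' u v u' v' : ℕ} {d d' e e' : Dir}
    (h : At g p T x y d) (h' : At g p' T x' y' d') (hx : x < x')
    (k : At g p (T + 1) u v e) (k' : At g p' (T + 1) u' v' e') :
    u < u' ∨ (u = u' ∧ e = Dir.east ∧ e' = Dir.north) := by
  rcases k.cases_succ h.inv.1 with ⟨rfl, _, d1, ha, hb⟩ | ⟨rfl, y1, d1, rfl, _, ha, hb⟩ <;>
  rcases k'.cases_succ h'.inv.1 with ⟨rfl, _, d2, hc, hd⟩ | ⟨rfl, y2, d2, rfl, _, hc, hd⟩ <;>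
  have e1 := (ha.det h).1 <;> have e2 := (hc.det h').1
  · left; omega
  · left; omega
  · by_cases u = u'
    · right; exact ⟨by assumption, rfl, rfl⟩
    · left; omega
  · left; omega

theorem order_init {g : Grid} {p p' : ℕ} (hpp : p < p') (T : ℕ) :
    ∀ {x y x' y' : ℕ} {d d' : Dir}, At g p T x y d → At g p' T x' y' d' →
    (∀ T0 < T, ∀ a b e e', At g p T0 a b e → At g p' T0 a b e' → False) →
    x < x' ∨ (x = x' ∧ d = Dir.east ∧ d' = Dir.north) := by
  induction T with
  | zero => intro x y x' y' d d' h h' _; have := h'.inv; omega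
  | succ T ih =>
    intro x y x' y' d d' h h' hno
    by_cases hT : p' ≤ T
    · obtain ⟨x1, y1, d1, h1, _⟩ := h.exists_le T (by omega) (by omega)
      obtain ⟨x2, y2, d2, h2, _⟩ := h'.exists_le T (by omega) (by omega)
      rcases ih h1 h2 (fun T0 hT0 => hno T0 (by omega)) with hlt | ⟨rfl, _, _⟩
      · exact step_order h1 h2 hlt h h'
      · obtain rfl : y1 = y2 := by have := h1.inv; have := h2.inv; omega
        exact (hno T (by omega) _ _ _ _ h1 h2).elim
    · have hi := h'.inv
      obtain rfl : p' = T + 1 := by omega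
      obtain ⟨rfl, rfl, rfl⟩ := h'.at_start
      have hi1 := h.inv
      by_cases hx : x = g.n
      · subst hx
        exact Or.inr ⟨rfl, h.row_n (by omega), rfl⟩
      · left; omega

theorem order_fwd {g : Grid} {p p' T0 x0 y0 x0' y0' : ℕ} {d0 d0' : Dir}
    (h0 : At g p T0 x0 y0 d0) (h0' : At g p' T0 x0' y0' d0') (hx : x0 < x0') (m : ℕ) :
    ∀ {x y x' y' : ℕ} {d d' : Dir}, At g p (T0 + m) x y d → At g p' (T0 + m) x' y' d' →
    (∀ T1, T0 < T1 → T1 ≤ T0 + m →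
      ∀ a b e e', At g p T1 a b e → At g p' T1 a b e' → False) → x < x' := by
  induction m with
  | zero =>
    intro x y x' y' d d' h h' _
    have := h.det h0; have := h'.det h0'; omega
  | succ m ih =>
    intro x y x' y' d d' h h' hno
    have i0 := h0.inv
    have i0' := h0'.inv
    obtain ⟨x1, y1, d1, h1, _⟩ := h.exists_le (T0 + m) (by omega) (by omega)
    obtain ⟨x2, y2, d2, h2, _⟩ := h'.exists_le (T0 + m) (by omega) (by omega)
    have hlt := ih h1 h2 (fun T1 a b => hno T1 a (by omega))
    rcases step_order h1 h2 hlt h h' with hh | ⟨rfl, _, _⟩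
    · exact hh
    · obtain rfl : y = y' := by have := h.inv; have := h'.inv; omega
      exact (hno _ (by omega) (by omega) _ _ _ _ h h').elim

theorem exit_order {g : Grid} {p p' T0 x0 y0 x0' y0' r r' : ℕ} {d0 d0' : Dir}
    (hp' : 1 ≤ p') (hpn' : p' ≤ g.n)
    (h0 : At g p T0 x0 y0 d0) (h0' : At g p' T0 x0' y0' d0') (hx : x0 < x0')
    (hno : ∀ T1, T0 < T1 → ∀ a b e e', At g p T1 a b e → At g p' T1 a b e' → False)
    (hr : Exits g p r) (hr' : Exits g p' r') : r < r' := by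
  obtain ⟨T, d, h1, h2⟩ := hr
  obtain ⟨T', d', h1', h2'⟩ := hr'
  have m1 := Exits.max h1 h2 h0
  have i1 := h1.inv
  have i1' := h1'.inv
  have i0 := h0'.inv
  by_cases hTT : T ≤ T'
  · obtain ⟨x1, y1, d1, h3, _⟩ := h1'.exists_le T (by omega) hTT
    obtain ⟨m, rfl⟩ : ∃ m, T = T0 + m := ⟨T - T0, by omega⟩
    have := order_fwd h0 h0' hx m h1 h3 (fun T1 a _ => hno T1 a)
    have := h3.inv; have := h3.inv2 hp' hpn'
    omega
  · omega

theorem cross_order {g : Grid} (hg : IsBPD g) {p p' T x y r r' : ℕ} {d d' : Dir} (hpp : p < p')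
    (hp : 1 ≤ p) (hpn' : p' ≤ g.n)
    (h : At g p T x y d) (h' : At g p' T x y d') (hr : Exits g p r) (hr' : Exits g p' r') :
    d = Dir.east ∧ d' = Dir.north ∧ r' < r := by
  have hun : ∀ T1 a b e e', At g p T1 a b e → At g p' T1 a b e' → T = T1 := by
    intro T1 a b e e' k k'
    exact meet_unique hg h h' k k' (by omega) hp (by omega) (by omega) hpn'
  have hc := meet_cross hg h h' (by omega) hp (by omega) (by omega) hpn'
  have hd : d = Dir.east ∧ d' = Dir.north := by
    rcases order_init hpp T h h' (fun T0 hT a b e e' k k' => by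
      have := hun _ _ _ _ _ k k'; omega) with hh | hh
    · omega
    · exact hh.2
  obtain ⟨rfl, rfl⟩ := hd
  refine ⟨rfl, rfl, ?_⟩
  -- the pipe p' moves north
  have hi := h.inv
  have hx2 := h'.inv2 (by omega) hpn'
  have hy2 := h.inv2 hp (by omega)
  have hx1 : x ≠ 1 := by
    rintro rfl
    have := hg.2.2.2.2.2.1 y (by omega) (by omega)
    rw [hc] at this; simp [hasN] at this
  obtain ⟨x', rfl⟩ : ∃ x', x = x' + 1 := ⟨x - 1, by omega⟩
  have k' : At g p' (T + 1) x' y Dir.north := At.north h' (by rw [hc]; rfl) (by omega)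
  by_cases hy : y < g.n
  · have k : At g p (T + 1) (x' + 1) (y + 1) Dir.east := At.east h (by rw [hc]; rfl) hy
    refine exit_order hp (by omega) k' k (by omega) ?_ hr' hr
    intro T1 hT1 a b e e' q q'
    have := hun _ _ _ _ _ q' q
    omega
  · obtain rfl : y = g.n := by omega
    have : Exits g p (x' + 1) := ⟨_, _, h, by rw [hc]; rfl⟩
    obtain rfl := hr.unique this
    obtain ⟨T', d', q1, q2⟩ := hr'
    have := Exits.max q1 q2 k'
    have := q1.inv
    omega

theorem noncross_order {g : Grid} (hg : IsBPD g) {p p' T x y x' y' r r' : ℕ} {d d' : Dir}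
    (hpp : p < p') (hp : 1 ≤ p) (hpn' : p' ≤ g.n)
    (h : At g p T x y d) (h' : At g p' T x' y' d') (hr : Exits g p r) (hr' : Exits g p' r')
    (hrr : r < r') : x < x' := by
  have hno : ∀ T1 a b e e', At g p T1 a b e → At g p' T1 a b e' → False := by
    intro T1 a b e e' k k'
    have := (cross_order hg hpp hp hpn' k k' hr hr').2.2
    omega
  rcases order_init hpp T h h' (fun T0 _ => hno T0) with hh | ⟨rfl, _⟩
  · exact hh
  · obtain rfl : y = y' := by have := h.inv; have := h'.inv; omega
    exact (hno _ _ _ _ _ h h').elim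



theorem MemBPD.exits {v : Perm'} {g : Grid} (h : MemBPD v g) {c : ℕ} (h1 : 1 ≤ c)
    (h2 : c ≤ g.n) : Exits g c (v.symm c) :=
  exits_of_traceAux h1 h2 _ At.start (h.2.2.2 c h1 h2)

theorem Exits.le {g : Grid} {p r : ℕ} (h : Exits g p r) (h1 : 1 ≤ p) (h2 : p ≤ g.n) :
    1 ≤ r ∧ r ≤ g.n := by
  obtain ⟨T, d, ha, _⟩ := h
  exact ⟨(ha.inv2 h1 h2).1, ha.inv.2.2.1⟩

theorem At.col_up {g : Grid} {p T b a : ℕ} (m : ℕ) (h : At g p T (a + m) b Dir.north)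
    (ha : 1 ≤ a)
    (ht : ∀ c, a < c → c ≤ a + m → outDir (g.tile c b) Dir.north = some Dir.north) :
    At g p (T + m) a b Dir.north := by
  induction m generalizing T with
  | zero => exact h
  | succ m ih =>
    have h1 : At g p (T + 1) (a + m) b Dir.north :=
      At.north h (ht _ (by omega) (by omega)) (by omega)
    have := ih h1 (fun c hc hc' => ht c hc (by omega))
    have e : T + 1 + m = T + (m + 1) := by omega
    rwa [e] at this

theorem At.row_right {g : Grid} {p T a b : ℕ} (m : ℕ) (h : At g p T a b Dir.east)
    (hb : b + m ≤ g.n)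
    (ht : ∀ c, b ≤ c → c < b + m → outDir (g.tile a c) Dir.east = some Dir.east) :
    At g p (T + m) a (b + m) Dir.east := by
  induction m with
  | zero => exact h
  | succ m ih =>
    have h1 := ih (by omega) (fun c hc hc' => ht c hc (by omega))
    exact At.east (T := T + m) (y := b + m) h1 (ht (b + m) (by omega) (by omega)) (by omega)

theorem col_down {g : Grid} (hg : IsBPD g) {a b : ℕ} (ha : 1 ≤ a) (hb : 1 ≤ b) (hbn : b ≤ g.n)
    (hS : hasS (g.tile a b) = true)
    (hno : ∀ c, a < c → c ≤ g.n → g.tile c b ≠ Tile.nw) :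
    ∀ c, a < c → c ≤ g.n → g.tile c b = Tile.vert ∨ g.tile c b = Tile.cross := by
  have key : ∀ m, a + m ≤ g.n → hasS (g.tile (a + m) b) = true ∧
      (1 ≤ m → g.tile (a + m) b = Tile.vert ∨ g.tile (a + m) b = Tile.cross) := by
    intro m
    induction m with
    | zero => intro _; exact ⟨hS, by omega⟩
    | succ m ih =>
      intro hm
      have h1 := (ih (by omega)).1
      have h2 := hg.2.2.2.1 (a + m) b (by omega) (by omega) hb hbn
      rw [h1] at h2
      have h3 := hno (a + (m + 1)) (by omega) hm
      have h4 := hg.2.2.1 (a + (m + 1)) b ⟨by omega, hm, hb, hbn⟩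
      have e : a + m + 1 = a + (m + 1) := by omega
      rw [e] at h2
      revert h2 h3 h4
      cases g.tile (a + (m + 1)) b <;> simp [hasN, hasS]
  intro c hc hcn
  obtain ⟨m, rfl⟩ : ∃ m, c = a + m := ⟨c - a, by omega⟩
  exact (key m hcn).2 (by omega)

theorem row_right {g : Grid} (hg : IsBPD g) {a b : ℕ} (hb : 1 ≤ b) (ha : 1 ≤ a) (han : a ≤ g.n)
    (hE : hasE (g.tile a b) = true)
    (hno : ∀ c, b < c → c ≤ g.n → g.tile a c ≠ Tile.nw) :
    ∀ c, b < c → c ≤ g.n → g.tile a c = Tile.horiz ∨ g.tile a c = Tile.cross := by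
  have key : ∀ m, b + m ≤ g.n → hasE (g.tile a (b + m)) = true ∧
      (1 ≤ m → g.tile a (b + m) = Tile.horiz ∨ g.tile a (b + m) = Tile.cross) := by
    intro m
    induction m with
    | zero => intro _; exact ⟨hE, by omega⟩
    | succ m ih =>
      intro hm
      have h1 := (ih (by omega)).1
      have h2 := hg.2.2.2.2.1 a (b + m) ha han (by omega) (by omega)
      rw [h1] at h2
      have h3 := hno (b + (m + 1)) (by omega) hm
      have h4 := hg.2.2.1 a (b + (m + 1)) ⟨ha, han, by omega, hm⟩
      have e : b + m + 1 = b + (m + 1) := by omega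
      rw [e] at h2
      revert h2 h3 h4
      cases g.tile a (b + (m + 1)) <;> simp [hasE, hasW]
  intro c hc hcn
  obtain ⟨m, rfl⟩ : ∃ m, c = b + m := ⟨c - b, by omega⟩
  exact (key m hcn).2 (by omega)

/-- A pipe that goes straight up its column. -/
theorem At.straight_up {g : Grid} {a b : ℕ} (ha : 1 ≤ a) (han : a ≤ g.n)
    (ht : ∀ c, a < c → c ≤ g.n → g.tile c b = Tile.vert ∨ g.tile c b = Tile.cross) :
    At g b (b + (g.n - a)) a b Dir.north := by
  refine At.col_up (g.n - a) ?_ ha ?_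
  · have e : a + (g.n - a) = g.n := by omega
    rw [e]; exact At.start
  · intro c hc hc'
    rcases ht c hc (by omega) with h | h <;> rw [h] <;> rfl

/-- A pipe that goes straight to the right exits. -/
theorem Exits.of_straight {g : Grid} {p T a b : ℕ} {d : Dir} (h : At g p T a b d)
    (hb : b ≤ g.n) (ho : outDir (g.tile a b) d = some Dir.east)
    (ht : ∀ c, b < c → c ≤ g.n → g.tile a c = Tile.horiz ∨ g.tile a c = Tile.cross) :
    Exits g p a := by
  rcases Nat.lt_or_ge b g.n with hlt | hge
  · have h1 := At.east h ho hlt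
    have h2 := At.row_right (g.n - (b + 1)) h1 (by omega) (fun c hc hc' => by
      rcases ht c (by omega) (by omega) with h | h <;> rw [h] <;> rfl)
    have e : b + 1 + (g.n - (b + 1)) = g.n := by omega
    rw [e] at h2
    refine ⟨_, _, h2, ?_⟩
    rcases ht g.n hlt (le_refl _) with h | h <;> rw [h] <;> rfl
  · obtain rfl : b = g.n := by omega
    exact ⟨_, _, h, ho⟩

theorem hook {g : Grid} (hg : IsBPD g) {a b : ℕ} (hab : InGrid g a b)
    (hse : g.tile a b = Tile.se)
    (h1 : ∀ c, a < c → c ≤ g.n → g.tile c b ≠ Tile.nw)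
    (h2 : ∀ c, b < c → c ≤ g.n → g.tile a c ≠ Tile.nw) : Exits g b a := by
  obtain ⟨ha, han, hb, hbn⟩ := hab
  refine Exits.of_straight (At.straight_up ha han
    (col_down hg ha hb hbn (by rw [hse]; rfl) h1)) hbn (by rw [hse]; rfl)
    (row_right hg hb ha han (by rw [hse]; rfl) h2)

theorem find_se_row {g : Grid} (hg : IsBPD g) {a b : ℕ} (hab : InGrid g a b)
    (hE : hasE (g.tile a b) = false) : ∃ b', b < b' ∧ b' ≤ g.n ∧ g.tile a b' = Tile.se := by
  obtain ⟨ha, han, hb, hbn⟩ := hab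
  by_contra hcon
  push Not at hcon
  have key : ∀ m, b + m ≤ g.n → hasE (g.tile a (b + m)) = false := by
    intro m
    induction m with
    | zero => intro _; exact hE
    | succ m ih =>
      intro hm
      have h1 := ih (by omega)
      have h2 := hg.2.2.2.2.1 a (b + m) ha han (by omega) (by omega)
      rw [h1] at h2
      have h3 := hcon (b + (m + 1)) (by omega) hm
      have e : b + m + 1 = b + (m + 1) := by omega
      rw [e] at h2
      revert h2 h3
      cases g.tile a (b + (m + 1)) <;> simp [hasE, hasW]
  have h1 := key (g.n - b) (by omega)
  have e : b + (g.n - b) = g.n := by omega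
  rw [e, hg.2.2.2.2.2.2.2.2.1 a ha han] at h1
  simp at h1

theorem find_se_col {g : Grid} (hg : IsBPD g) {a b : ℕ} (hab : InGrid g a b)
    (hS : hasS (g.tile a b) = false) : ∃ a', a < a' ∧ a' ≤ g.n ∧ g.tile a' b = Tile.se := by
  obtain ⟨ha, han, hb, hbn⟩ := hab
  by_contra hcon
  push Not at hcon
  have key : ∀ m, a + m ≤ g.n → hasS (g.tile (a + m) b) = false := by
    intro m
    induction m with
    | zero => intro _; exact hS
    | succ m ih =>
      intro hm
      have h1 := ih (by omega)
      have h2 := hg.2.2.2.1 (a + m) b (by omega) (by omega) hb hbn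
      rw [h1] at h2
      have h3 := hcon (a + (m + 1)) (by omega) hm
      have e : a + m + 1 = a + (m + 1) := by omega
      rw [e] at h2
      revert h2 h3
      cases g.tile (a + (m + 1)) b <;> simp [hasS, hasN]
  have h1 := key (g.n - a) (by omega)
  have e : a + (g.n - a) = g.n := by omega
  rw [e, hg.2.2.2.2.2.2.1 b hb hbn] at h1
  simp at h1

/-- In a bumpless pipe dream of a vexillary permutation there is no blank tile and no
`nw`-elbow strictly southeast of a crossing. -/
theorem noQ {v : Perm'} {g : Grid} (hv : Vexillary v) (hB : MemBPD v g) {i j T x y : ℕ}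
    {d d' : Dir} (hi : 1 ≤ i) (hij : i < j) (hj : j ≤ g.n)
    (ai : At g i T x y d) (aj : At g j T x y d') :
    ∀ a b, x < a → a ≤ g.n → y < b → b ≤ g.n → g.tile a b ≠ Tile.nw ∧ g.tile a b ≠ Tile.blank := by
  have hg := hB.1
  have ei := hB.exits hi (by omega)
  have ej := hB.exits (by omega : 1 ≤ j) hj
  have hlt := (cross_order hg hij hi hj ai aj ei ej).2.2
  have hri : v.symm i ≤ x := by
    obtain ⟨T', e, k1, k2⟩ := ei
    exact (k1.mono ai (Exits.max k1 k2 ai)).1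
  have hjy := aj.inv
  have hx1 := ai.inv2 hi (by omega)
  have hrj1 := (ej.le (by omega) hj).1
  have main : ∀ m a b, 2 * g.n - (a + b) = m → x < a → a ≤ g.n → y < b → b ≤ g.n →
      g.tile a b ≠ Tile.nw ∧ g.tile a b ≠ Tile.blank := by
    intro m
    induction m using Nat.strong_induction_on with
    | _ m ih =>
      intro a b hm hxa han hyb hbn
      by_contra hcon
      have hES : hasE (g.tile a b) = false ∧ hasS (g.tile a b) = false := by
        revert hcon; cases g.tile a b <;> simp [hasE, hasS]
      have hbig : ∀ a' b', a ≤ a' → b ≤ b' → a + b < a' + b' → a' ≤ g.n → b' ≤ g.n →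
          g.tile a' b' ≠ Tile.nw := by
        intro a' b' h1 h2 h3 h4 h5
        exact (ih (2 * g.n - (a' + b')) (by omega) a' b' rfl (by omega) h4 (by omega) h5).1
      have hin : InGrid g a b := ⟨by omega, han, by omega, hbn⟩
      obtain ⟨b', hb1, hb2, hb3⟩ := find_se_row hg hin hES.1
      obtain ⟨a', ha1, ha2, ha3⟩ := find_se_col hg hin hES.2
      have k1 : Exits g b' a := hook hg ⟨by omega, han, by omega, hb2⟩ hb3
        (fun c h1 h2 => hbig _ _ (by omega) (by omega) (by omega) h2 hb2)
        (fun c h1 h2 => hbig _ _ (by omega) (by omega) (by omega) han h2)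
      have k2 : Exits g b a' := hook hg ⟨by omega, ha2, by omega, hbn⟩ ha3
        (fun c h1 h2 => hbig _ _ (by omega) (by omega) (by omega) h2 hbn)
        (fun c h1 h2 => hbig _ _ (by omega) (by omega) (by omega) ha2 h2)
      have e1 := k1.unique (hB.exits (by omega) hb2)
      have e2 := k2.unique (hB.exits (by omega) hbn)
      have f1 : v a = b' := by rw [e1]; simp
      have f2 : v a' = b := by rw [e2]; simp
      refine hv.2 ⟨v.symm j, v.symm i, a, a', hrj1, hlt, by omega, by omega, ?_, ?_, ?_⟩
      · simpa using hij
      · rw [f2]; simp; omega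
      · rw [f1, f2]; exact hb1
  intro a b
  exact main _ a b rfl

/-- A pipe starting weakly left of column `y` which is strictly southeast of `(x, y)`, where
this quadrant has no `nw`-elbow, is heading east and exits in its current row. -/
theorem inQ_exit {g : Grid} {p x y T a b r : ℕ} {d : Dir}
    (hQ : ∀ a b, x < a → a ≤ g.n → y < b → b ≤ g.n → g.tile a b ≠ Tile.nw ∧ g.tile a b ≠ Tile.blank)
    (hnb : ∀ i j, InGrid g i j → g.tile i j ≠ Tile.bump)
    (hp : 1 ≤ p) (hpn : p ≤ g.n) (hpy : p ≤ y) (h : At g p T a b d) (hxa : x < a) (hyb : y < b)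
    (hr : Exits g p r) : r = a := by
  have key : ∀ {T a b d}, At g p T a b d → x < a → y < b → d = Dir.east := by
    intro T a b d h
    induction h with
    | start => omega
    | @north T a b d h1 h2 h3 ih =>
      intro ha hb
      have hi := h1.inv
      have hi2 := h1.inv2 hp hpn
      obtain rfl := ih (by omega) hb
      have := (hQ (a + 1) b (by omega) (by omega) hb (by omega)).1
      have := hnb (a + 1) b (h1.inGrid hp hpn)
      revert h2
      cases hh : g.tile (a + 1) b <;> simp_all [outDir]
    | east => intros; rfl
  obtain ⟨T', d', k1, k2⟩ := hr
  have hT := Exits.max k1 k2 h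
  have step : ∀ m x' y' d', At g p (T + m) x' y' d' → x' = a := by
    intro m
    induction m with
    | zero => intro x' y' d' h'; exact (h'.det h).1
    | succ m ih =>
      intro x' y' d' h'
      have hi := h.inv
      rcases At.cases_succ (T := T + m) h' (by omega) with
        ⟨rfl, _, d1, ha, hb⟩ | ⟨rfl, y1, d1, rfl, _, ha, hb⟩
      · exfalso
        have e := ih _ _ _ ha
        have hi := ha.inv
        have hi2 := ha.inv2 hp hpn
        have hm := ha.mono h (by omega)
        obtain rfl := key ha (by omega) (by omega)
        have := (hQ (x' + 1) y' (by omega) (by omega) (by omega) (by omega)).1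
        have := hnb (x' + 1) y' (ha.inGrid hp hpn)
        revert hb
        cases hh : g.tile (x' + 1) y' <;> simp_all [outDir]
      · exact ih _ _ _ ha
  obtain ⟨m, rfl⟩ : ∃ m, T' = T + m := ⟨T' - T, by omega⟩
  exact step m _ _ _ k1



/-! ### Shapes -/

theorem insDesc_perm (x : ℕ) (l : List ℕ) : (insDesc x l).Perm (x :: l) := by
  induction l with
  | nil => exact List.Perm.refl _
  | cons y ys ih =>
    rw [insDesc]
    split_ifs
    · exact List.Perm.refl _
    · exact (List.Perm.cons y ih).trans (List.Perm.swap x y ys)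

theorem sortDesc_perm (l : List ℕ) : (sortDesc l).Perm l := by
  induction l with
  | nil => exact List.Perm.refl _
  | cons x l ih => exact (insDesc_perm x _).trans (List.Perm.cons x ih)

theorem insDesc_sorted (x : ℕ) (l : List ℕ) (h : l.Pairwise (· ≥ ·)) :
    (insDesc x l).Pairwise (· ≥ ·) := by
  induction l with
  | nil => simp [insDesc]
  | cons y ys ih =>
    rw [List.pairwise_cons] at h
    rw [insDesc]
    split_ifs with hxy
    · rw [List.pairwise_cons]
      refine ⟨?_, List.pairwise_cons.2 h⟩
      intro a ha
      rcases List.mem_cons.1 ha with rfl | ha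
      · show a ≤ x
        omega
      · have := h.1 a ha
        show a ≤ x
        simp only [ge_iff_le] at this
        omega
    · rw [List.pairwise_cons]
      refine ⟨?_, ih h.2⟩
      intro a ha
      rcases List.mem_cons.1 ((insDesc_perm x ys).mem_iff.1 ha) with rfl | ha
      · show a ≤ y
        omega
      · exact h.1 a ha

theorem sortDesc_sorted (l : List ℕ) : (sortDesc l).Pairwise (· ≥ ·) := by
  induction l with
  | nil => exact List.Pairwise.nil
  | cons x l ih => exact insDesc_sorted x _ ih

theorem sortDesc_eq {l l' : List ℕ} (h : l.Perm l') : sortDesc l = sortDesc l' := by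
  refine List.Perm.eq_of_pairwise (le := (· ≥ ·)) ?_ (sortDesc_sorted l) (sortDesc_sorted l')
    ((sortDesc_perm l).trans (h.trans (sortDesc_perm l').symm))
  intro a b _ _ h1 h2
  exact le_antisymm h2 h1

theorem code_congr {v v' : Perm'} {r r' : ℕ} (e : ℕ ≃ ℕ)
    (h : ∀ s, (r < s ∧ v' s < v' r) ↔ (r' < e s ∧ v (e s) < v r')) :
    codeOf v' r = codeOf v r' :=
  Nat.card_congr (Equiv.subtypeEquiv e h)

theorem shape_eq {v v' : Perm'} {n a b c : ℕ} (hab : a < b) (hbc : b < c) (h1 : 1 ≤ a)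
    (hcn : c ≤ n) (hi : v b < v a) (hj : v a < v c) (ha : v' a = v b) (hb : v' b = v c)
    (hc : v' c = v a) (ho : ∀ s, s ≠ a → s ≠ b → s ≠ c → v' s = v s)
    (hIA : ∀ s, a < s → s < b → ¬ v s < v b)
    (hIB : ∀ s, a < s → s < b → ¬ (v b < v s ∧ v s < v a))
    (hIIC : ∀ s, b < s → s < c → ¬ (v a < v s ∧ v s < v c))
    (hIIIC : ∀ s, c < s → ¬ (v a < v s ∧ v s < v c)) : shapeOf v n = shapeOf v' n := by
  have inj : ∀ s t, v s = v t → s = t := fun s t h => v.injective h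
  have hI : ∀ s, a < s → s < b → v a < v s := by
    intro s h2 h3
    have := hIA s h2 h3
    have := hIB s h2 h3
    have := inj s a
    have := inj s b
    omega
  have hII : ∀ s, b < s → s ≠ c → v s ≤ v a ∨ v c ≤ v s := by
    intro s h2 h3
    rcases Nat.lt_or_gt_of_ne h3 with h4 | h4
    · have := hIIC s h2 h4; omega
    · have := hIIIC s h4; omega
  have key : ∀ r, codeOf v' r = codeOf v (Equiv.swap a b r) := by
    intro r
    by_cases ra : r = a
    · subst ra
      rw [Equiv.swap_apply_left]
      refine code_congr (Equiv.refl ℕ) ?_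
      intro s
      simp only [Equiv.refl_apply]
      by_cases sr : s = r
      · subst sr; omega
      by_cases sb : s = b
      · subst sb; omega
      by_cases sc : s = c
      · subst sc; omega
      rw [ho s sr sb sc, ha]
      have := hIA s
      omega
    by_cases rb : r = b
    · subst rb
      rw [Equiv.swap_apply_right]
      refine code_congr (Equiv.swap r c) ?_
      intro s
      by_cases sr : s = r
      · subst sr; rw [Equiv.swap_apply_left]; omega
      by_cases sc : s = c
      · subst sc; rw [Equiv.swap_apply_right]; omega
      rw [Equiv.swap_apply_of_ne_of_ne sr sc]
      by_cases sa : s = a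
      · subst sa; omega
      rw [ho s sa sr sc, hb]
      have h2 := hI s
      have h3 := hII s
      have h4 := inj s a
      omega
    rw [Equiv.swap_apply_of_ne_of_ne ra rb]
    by_cases rc : r = c
    · subst rc
      refine code_congr (Equiv.refl ℕ) ?_
      intro s
      simp only [Equiv.refl_apply]
      by_cases h5 : r < s
      · rw [ho s (by omega) (by omega) (by omega), hc]
        have h3 := hII s
        have h4 := inj s a
        omega
      · omega
    have hr := ho r ra rb rc
    have na := inj r a
    have nb := inj r b
    have nc := inj r c
    rcases Nat.lt_or_gt_of_ne ra with hra | hra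
    · refine code_congr (v'.trans v.symm) ?_
      intro s
      simp only [Equiv.trans_apply, Equiv.apply_symm_apply, hr]
      have : r < s ↔ r < v.symm (v' s) := by
        by_cases sa : s = a
        · subst sa; rw [ha]; simp; omega
        by_cases sb : s = b
        · subst sb; rw [hb]; simp; omega
        by_cases sc : s = c
        · subst sc; rw [hc]; simp; omega
        rw [ho s sa sb sc]; simp
      rw [this]
    rcases Nat.lt_or_gt_of_ne rb with hrb | hrb
    · refine code_congr (Equiv.swap b c) ?_
      intro s
      have h2 := hI r hra hrb
      by_cases sb : s = b
      · subst sb; rw [Equiv.swap_apply_left]; omega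
      by_cases sc : s = c
      · subst sc; rw [Equiv.swap_apply_right]; omega
      rw [Equiv.swap_apply_of_ne_of_ne sb sc]
      by_cases sa : s = a
      · subst sa; omega
      rw [ho s sa sb sc, hr]
    · refine code_congr (Equiv.refl ℕ) ?_
      intro s
      simp only [Equiv.refl_apply]
      by_cases h5 : r < s
      · by_cases sc : s = c
        · subst sc
          have := hII r hrb rc
          omega
        rw [ho s (by omega) (by omega) (by omega), hr]
      · omega
  have hperm : ((List.range' 1 n).map (codeOf v')).Perm ((List.range' 1 n).map (codeOf v)) := by
    have e : (List.range' 1 n).map (codeOf v') =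
        ((List.range' 1 n).map (Equiv.swap a b)).map (codeOf v) := by
      rw [List.map_map]
      exact List.map_congr_left (fun r _ => key r)
    rw [e]
    refine List.Perm.map _ ?_
    rw [List.perm_ext_iff_of_nodup]
    · intro s
      simp only [List.mem_map, List.mem_range'_1]
      constructor
      · rintro ⟨t, ht, rfl⟩
        rw [Equiv.swap_apply_def]
        split_ifs <;> omega
      · intro hs
        refine ⟨Equiv.swap a b s, ?_, by simp⟩
        rw [Equiv.swap_apply_def]
        split_ifs <;> omega
    · exact List.Nodup.map (Equiv.injective _) (List.nodup_range' (s := 1) (n := n))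
    · exact List.nodup_range'
  rw [shapeOf, shapeOf, sortDesc_eq hperm]



/-! ### The min-droop of a crossing turned into a bump -/

theorem leastOff_spec {p : ℕ → Bool} {bound t : ℕ} (h1 : 1 ≤ t) (h2 : t ≤ bound + 1)
    (ht : p t = true) :
    1 ≤ leastOff p bound ∧ p (leastOff p bound) = true ∧
      ∀ m, 1 ≤ m → m < leastOff p bound → p m = false := by
  have e : leastOff p bound = ((List.range' 1 (bound + 1)).find? p).getD 1 := by
    rw [leastOff, ← List.head?_filter, List.headD_eq_head?_getD]
  cases hf : (List.range' 1 (bound + 1)).find? p with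
  | none =>
    rw [List.find?_eq_none] at hf
    have := hf t (by rw [List.mem_range'_1]; omega)
    simp [ht] at this
  | some s =>
    rw [e, hf]
    simp only [Option.getD_some]
    rw [List.find?_range'_eq_some] at hf
    obtain ⟨h3, h4, h5⟩ := hf
    rw [List.mem_range'_1] at h4
    refine ⟨by omega, h3, ?_⟩
    intro m hm hms
    have := h5 m hm hms
    simpa using this

def fS : Tile → Tile
  | .vert => .se | t => t
def fE : Tile → Tile
  | .horiz => .se | .nw => .vert | t => t
def fC : Tile → Tile
  | .blank => .nw | .se => .bump | t => t
def fR : Tile → Tile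
  | .blank => .horiz | .vert => .cross | t => t
def fD : Tile → Tile
  | .blank => .vert | .horiz => .cross | t => t

/-- The boundary of the rectangle of the droop. -/
def OnBd (x y k l a b : ℕ) : Prop :=
  x ≤ a ∧ a ≤ x + k ∧ y ≤ b ∧ b ≤ y + l ∧ (a = x ∨ a = x + k ∨ b = y ∨ b = y + l)

structure Droop1 (B g : Grid) (x y k l : ℕ) : Prop where
  hk : 1 ≤ k
  hl : 1 ≤ l
  n : g.n = B.n
  colc : ∀ a, x < a → a < x + k → B.tile a y = Tile.cross
  colk : B.tile (x + k) y ≠ Tile.cross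
  rowc : ∀ b, y < b → b < y + l → B.tile x b = Tile.cross
  rowl : B.tile x (y + l) ≠ Tile.cross
  z : g.tile x y = Tile.nw
  tS : g.tile (x + k) y = fS (B.tile (x + k) y)
  tE : g.tile x (y + l) = fE (B.tile x (y + l))
  tC : g.tile (x + k) (y + l) = fC (B.tile (x + k) (y + l))
  colm : ∀ a, x < a → a < x + k → g.tile a y = Tile.horiz
  rowm : ∀ b, y < b → b < y + l → g.tile x b = Tile.vert
  tR : ∀ b, y < b → b < y + l → g.tile (x + k) b = fR (B.tile (x + k) b)
  tD : ∀ a, x < a → a < x + k → g.tile a (y + l) = fD (B.tile a (y + l))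
  other : ∀ a b, ¬ OnBd x y k l a b → g.tile a b = B.tile a b

theorem droop1 {B : Grid} (hB : ∀ i j, ¬ InGrid B i j → B.tile i j = Tile.horiz) {x y : ℕ}
    (hx : 1 ≤ x) (hy : 1 ≤ y) :
    ∃ k l, minDroopCorner (setTile B x y Tile.bump) x y = (x + k, y + l) ∧
      Droop1 B (minDroopT (setTile B x y Tile.bump) x y) x y k l := by
  obtain ⟨k, hk⟩ : ∃ k, leastOff (fun k => !((setTile B x y Tile.bump).tile (x + k) y
    == Tile.cross)) B.n = k := ⟨_, rfl⟩
  obtain ⟨l, hl⟩ : ∃ l, leastOff (fun l => !((setTile B x y Tile.bump).tile x (y + l)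
    == Tile.cross)) B.n = l := ⟨_, rfl⟩
  have sk := leastOff_spec (p := fun k => !((setTile B x y Tile.bump).tile (x + k) y
    == Tile.cross)) (bound := B.n) (t := B.n + 1) (by omega) (by omega) (by
      have := hB (x + (B.n + 1)) y (by unfold InGrid; omega)
      simp [setTile, this])
  have sl := leastOff_spec (p := fun l => !((setTile B x y Tile.bump).tile x (y + l)
    == Tile.cross)) (bound := B.n) (t := B.n + 1) (by omega) (by omega) (by
      have := hB x (y + (B.n + 1)) (by unfold InGrid; omega)
      simp [setTile, this])
  rw [hk] at sk
  rw [hl] at sl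
  obtain ⟨k1, k2, k3⟩ := sk
  obtain ⟨l1, l2, l3⟩ := sl
  have e2 : B.tile (x + k) y ≠ Tile.cross := by
    simp only [setTile] at k2
    rw [if_neg (by omega)] at k2
    simpa using k2
  have e2' : B.tile x (y + l) ≠ Tile.cross := by
    simp only [setTile] at l2
    rw [if_neg (by omega)] at l2
    simpa using l2
  have e3 : ∀ a, x < a → a < x + k → B.tile a y = Tile.cross := by
    intro a h1 h2
    have := k3 (a - x) (by omega) (by omega)
    simp only [setTile] at this
    rw [if_neg (by omega), show x + (a - x) = a by omega] at this
    simpa using this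
  have e3' : ∀ b, y < b → b < y + l → B.tile x b = Tile.cross := by
    intro a h1 h2
    have := l3 (a - y) (by omega) (by omega)
    simp only [setTile] at this
    rw [if_neg (by omega), show y + (a - y) = a by omega] at this
    simpa using this
  have hnn : (setTile B x y Tile.bump).n = B.n := rfl
  refine ⟨k, l, by rw [minDroopCorner, hnn, hk, hl], k1, l1, rfl, e3, e2, e3', e2',
    ?_, ?_, ?_, ?_, ?_, ?_, ?_, ?_, ?_⟩
  · simp [minDroopT, setTile]
  · simp only [minDroopT, hnn, hk, hl]
    simp only [setTile]
    refine (if_neg (by omega)).trans ?_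
    refine (if_pos (by first | omega | (simp; done) | (simp; omega))).trans ?_
    rw [if_neg (by omega)]
    cases B.tile (x + k) y <;> rfl
  · simp only [minDroopT, hnn, hk, hl]
    simp only [setTile]
    refine (if_neg (by omega)).trans ?_
    refine (if_neg (by omega)).trans ?_
    refine (if_pos (by first | omega | (simp; done) | (simp; omega))).trans ?_
    rw [if_neg (by omega)]
    cases B.tile x (y + l) <;> rfl
  · simp only [minDroopT, hnn, hk, hl]
    simp only [setTile]
    refine (if_neg (by omega)).trans ?_
    refine (if_neg (by omega)).trans ?_
    refine (if_neg (by omega)).trans ?_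
    refine (if_pos (by first | omega | (simp; done) | (simp; omega))).trans ?_
    rw [if_neg (by omega)]
    cases B.tile (x + k) (y + l) <;> rfl
  · intro a h1 h2
    simp only [minDroopT, hnn, hk, hl]
    simp only [setTile]
    refine (if_neg (by omega)).trans ?_
    refine (if_neg (by omega)).trans ?_
    refine (if_neg (by omega)).trans ?_
    refine (if_neg (by omega)).trans ?_
    refine (if_pos (by first | omega | (simp; done) | (simp; omega))).trans ?_
    rw [if_neg (by omega), e3 a h1 h2]
  · intro a h1 h2
    simp only [minDroopT, hnn, hk, hl]
    simp only [setTile]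
    refine (if_neg (by omega)).trans ?_
    refine (if_neg (by omega)).trans ?_
    refine (if_neg (by omega)).trans ?_
    refine (if_neg (by omega)).trans ?_
    refine (if_neg (by omega)).trans ?_
    refine (if_pos (by first | omega | (simp; done) | (simp; omega))).trans ?_
    rw [if_neg (by omega), e3' a h1 h2]
  · intro a h1 h2
    simp only [minDroopT, hnn, hk, hl]
    simp only [setTile]
    refine (if_neg (by omega)).trans ?_
    refine (if_neg (by omega)).trans ?_
    refine (if_neg (by omega)).trans ?_
    refine (if_neg (by omega)).trans ?_
    refine (if_neg (by omega)).trans ?_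
    refine (if_neg (by omega)).trans ?_
    refine (if_pos (by first | omega | (simp; done) | (simp; omega))).trans ?_
    rw [if_neg (by omega)]
    cases B.tile (x + k) a <;> rfl
  · intro a h1 h2
    simp only [minDroopT, hnn, hk, hl]
    simp only [setTile]
    refine (if_neg (by omega)).trans ?_
    refine (if_neg (by omega)).trans ?_
    refine (if_neg (by omega)).trans ?_
    refine (if_neg (by omega)).trans ?_
    refine (if_neg (by omega)).trans ?_
    refine (if_neg (by omega)).trans ?_
    refine (if_neg (by omega)).trans ?_
    refine (if_pos (by first | omega | (simp; done) | (simp; omega))).trans ?_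
    rw [if_neg (by omega)]
    cases B.tile a (y + l) <;> rfl
  · intro a b h
    unfold OnBd at h
    simp only [minDroopT, hnn, hk, hl]
    simp only [setTile]
    refine (if_neg (by omega)).trans ?_
    refine (if_neg (by omega)).trans ?_
    refine (if_neg (by omega)).trans ?_
    refine (if_neg (by omega)).trans ?_
    refine (if_neg (by omega)).trans ?_
    refine (if_neg (by omega)).trans ?_
    refine (if_neg (by omega)).trans ?_
    refine (if_neg (by omega)).trans ?_
    exact if_neg (by omega)



/-! ### The first step of the Huang bump at a crossing -/

structure Ctx (v : Perm') (B : Grid) (i j T x y : ℕ) : Prop where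
  hv : Vexillary v
  hB : MemBPD v B
  hi : 1 ≤ i
  hij : i < j
  hj : j ≤ B.n
  ai : At B i T x y Dir.east
  aj : At B j T x y Dir.north

theorem Ctx.noQ {v : Perm'} {B : Grid} {i j T x y : ℕ} (C : Ctx v B i j T x y) :
    ∀ a b, x < a → a ≤ B.n → y < b → b ≤ B.n →
      B.tile a b ≠ Tile.nw ∧ B.tile a b ≠ Tile.blank :=
  BPDPaper.noQ C.hv C.hB C.hi C.hij C.hj C.ai C.aj

theorem Ctx.z {v : Perm'} {B : Grid} {i j T x y : ℕ} (C : Ctx v B i j T x y) :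
    B.tile x y = Tile.cross :=
  meet_cross C.hB.1 C.ai C.aj (by have := C.hij; omega) C.hi
    (by have := C.hij; have := C.hj; omega) (by have := C.hij; omega) C.hj

theorem Ctx.bd {v : Perm'} {B : Grid} {i j T x y : ℕ} (C : Ctx v B i j T x y) :
    1 ≤ x ∧ x ≤ B.n ∧ 1 ≤ y ∧ y ≤ B.n :=
  C.aj.inGrid (by have := C.hij; omega) C.hj

structure Drp (B : Grid) (x y k l : ℕ) : Prop where
  hk : 1 ≤ k
  hl : 1 ≤ l
  hxk : x + k ≤ B.n
  hyl : y + l ≤ B.n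
  colc : ∀ a, x < a → a < x + k → B.tile a y = Tile.cross
  colk : B.tile (x + k) y = Tile.vert
  rowc : ∀ b, y < b → b < y + l → B.tile x b = Tile.cross
  rowl : B.tile x (y + l) = Tile.horiz ∨ B.tile x (y + l) = Tile.nw
  c : B.tile (x + k) (y + l) = Tile.se
  rc : ∀ b, y < b → b < y + l → B.tile (x + k) b = Tile.vert
  cr : ∀ a, x < a → a < x + k → B.tile a (y + l) = Tile.horiz

theorem drp_of {v : Perm'} {B g G : Grid} {i j T x y k l : ℕ} (C : Ctx v B i j T x y)
    (D : Droop1 B g x y k l) (hG : IsBPD G) (hn : G.n = B.n)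
    (hGg : ∀ a b, ¬ (a = x + k ∧ b = y + l) → G.tile a b = g.tile a b) : Drp B x y k l := by
  obtain ⟨hx, hxn, hy, hyn⟩ := C.bd
  have hQ := C.noQ
  have hz := C.z
  obtain ⟨b1, b2, b3, b4, b5, b6, b7, b8, b9, b10⟩ := C.hB.1
  obtain ⟨c1, c2, c3, c4, c5, c6, c7, c8, c9, c10⟩ := hG
  rw [hn] at c4 c5 c6 c7 c8 c9
  have hk := D.hk
  have hl := D.hl
  -- the row `y + l` is in the grid
  have hyl : y + l ≤ B.n := by
    by_contra hcon
    have e1 := b2 x (y + l) (by unfold InGrid; omega)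
    have e2 := c2 x (y + l) (by unfold InGrid; omega)
    rw [hGg _ _ (by omega), D.tE, e1] at e2
    simp [fE] at e2
  have up : hasS (G.tile (x + k - 1) y) = false := by
    rw [hGg _ _ (by omega)]
    by_cases hk1 : k = 1
    · rw [show x + k - 1 = x by omega, D.z]; rfl
    · rw [D.colm _ (by omega) (by omega)]; rfl
  have upB : B.tile (x + k - 1) y = Tile.cross := by
    by_cases hk1 : k = 1
    · rw [show x + k - 1 = x by omega, hz]
    · rw [D.colc _ (by omega) (by omega)]
  have lfB : B.tile x (y + l - 1) = Tile.cross := by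
    by_cases hk1 : l = 1
    · rw [show y + l - 1 = y by omega, hz]
    · rw [D.rowc _ (by omega) (by omega)]
  have hup : x + k - 1 ≤ B.n := by
    by_contra hcon
    have e1 := b2 (x + k - 1) y (by unfold InGrid; omega)
    rw [upB] at e1
    simp at e1
  have hxk : x + k ≤ B.n := by
    by_contra hcon
    have e1 := c7 y hy hyn
    rw [show B.n = x + k - 1 by omega, up] at e1
    simp at e1
  have rowl : B.tile x (y + l) = Tile.horiz ∨ B.tile x (y + l) = Tile.nw := by
    have e1 := b5 x (y + l - 1) hx hxn (by omega) (by omega)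
    rw [lfB, show y + l - 1 + 1 = y + l by omega] at e1
    have e2 := D.rowl
    have e3 := b3 x (y + l) ⟨hx, hxn, by omega, by omega⟩
    revert e1 e2 e3
    cases B.tile x (y + l) <;> simp [hasE, hasW]
  have colk : B.tile (x + k) y = Tile.vert := by
    have e1 := b4 (x + k - 1) y (by omega) (by omega) hy hyn
    rw [upB, show x + k - 1 + 1 = x + k by omega] at e1
    have e2 := D.colk
    have e3 := b3 (x + k) y ⟨by omega, by omega, by omega, by omega⟩
    have e4 := c4 (x + k - 1) y (by omega) (by omega) hy hyn
    rw [up, show x + k - 1 + 1 = x + k by omega, hGg _ _ (by omega), D.tS] at e4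
    revert e1 e2 e3 e4
    cases B.tile (x + k) y <;> simp [hasS, hasN, fS]
  have colS : ∀ m, m < k → hasS (B.tile (x + m) (y + l)) = false ∧
      hasS (G.tile (x + m) (y + l)) = true ∧
      (1 ≤ m → B.tile (x + m) (y + l) = Tile.horiz) := by
    intro m
    induction m with
    | zero =>
      intro hm
      rw [hGg _ _ (by omega), Nat.add_zero, D.tE]
      rcases rowl with h | h <;> rw [h] <;> simp [fE, hasS]
    | succ m ih =>
      intro hm
      obtain ⟨h1, h2, -⟩ := ih (by omega)
      have e1 := b4 (x + m) (y + l) (by omega) (by omega) (by omega) hyl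
      have e2 := c4 (x + m) (y + l) (by omega) (by omega) (by omega) hyl
      have e3 := hQ (x + m + 1) (y + l) (by omega) (by omega) (by omega) hyl
      have e4 := b3 (x + m + 1) (y + l) ⟨by omega, by omega, by omega, hyl⟩
      have e5 := D.tD (x + m + 1) (by omega) (by omega)
      rw [h1] at e1
      rw [h2, hGg _ _ (by omega), e5] at e2
      rw [show x + (m + 1) = x + m + 1 by omega, hGg _ _ (by omega), e5]
      revert e1 e2 e3 e4
      cases B.tile (x + m + 1) (y + l) <;> simp [hasS, hasN, fD]
  have rowE : ∀ m, m < l → hasE (B.tile (x + k) (y + m)) = false ∧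
      hasE (G.tile (x + k) (y + m)) = true ∧
      (1 ≤ m → B.tile (x + k) (y + m) = Tile.vert) := by
    intro m
    induction m with
    | zero =>
      intro hm
      rw [hGg _ _ (by omega), Nat.add_zero, D.tS, colk]
      simp [fS, hasE]
    | succ m ih =>
      intro hm
      obtain ⟨h1, h2, -⟩ := ih (by omega)
      have e1 := b5 (x + k) (y + m) (by omega) (by omega) (by omega) (by omega)
      have e2 := c5 (x + k) (y + m) (by omega) (by omega) (by omega) (by omega)
      have e3 := hQ (x + k) (y + m + 1) (by omega) (by omega) (by omega) (by omega)
      have e4 := b3 (x + k) (y + m + 1) ⟨by omega, by omega, by omega, by omega⟩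
      have e5 := D.tR (y + m + 1) (by omega) (by omega)
      rw [h1] at e1
      rw [h2, hGg _ _ (by omega), e5] at e2
      rw [show y + (m + 1) = y + m + 1 by omega, hGg _ _ (by omega), e5]
      revert e1 e2 e3 e4
      cases B.tile (x + k) (y + m + 1) <;> simp [hasE, hasW, fR]
  have hc : B.tile (x + k) (y + l) = Tile.se := by
    have e1 := b4 (x + (k - 1)) (y + l) (by omega) (by omega) (by omega) hyl
    have e2 := b5 (x + k) (y + (l - 1)) (by omega) (by omega) (by omega) (by omega)
    rw [(colS (k - 1) (by omega)).1, show x + (k - 1) + 1 = x + k by omega] at e1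
    rw [(rowE (l - 1) (by omega)).1, show y + (l - 1) + 1 = y + l by omega] at e2
    have e3 := hQ (x + k) (y + l) (by omega) (by omega) (by omega) (by omega)
    revert e1 e2 e3
    cases B.tile (x + k) (y + l) <;> simp [hasN, hasW]
  refine ⟨hk, hl, hxk, hyl, D.colc, colk, D.rowc, rowl, hc, ?_, ?_⟩
  · intro b h1 h2
    have := (rowE (b - y) (by omega)).2.2 (by omega)
    rwa [show y + (b - y) = b by omega] at this
  · intro a h1 h2
    have := (colS (a - x) (by omega)).2.2 (by omega)
    rwa [show x + (a - x) = a by omega] at this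

theorem At.transport {B G : Grid} (hn : G.n = B.n) {p T x y : ℕ} {d : Dir} (h : At B p T x y d) :
    (∀ T' a b e, T' < T → At B p T' a b e →
      outDir (G.tile a b) e = outDir (B.tile a b) e) → At G p T x y d := by
  induction h with
  | start => intro _; rw [← hn]; exact At.start
  | @north T x y d h1 h2 h3 ih =>
    intro hag
    refine At.north (ih fun T' a b e hT => hag T' a b e (by omega)) ?_ h3
    rw [hag T _ _ _ (by omega) h1, h2]
  | @east T x y d h1 h2 h3 ih =>
    intro hag
    refine At.east (ih fun T' a b e hT => hag T' a b e (by omega)) ?_ (by omega)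
    rw [hag T _ _ _ (by omega) h1, h2]

/-- Before reaching the crossing horizontally, the pipe is strictly left of it. -/
theorem At.before_east {B : Grid} {i T x y : ℕ} (ai : At B i T x y Dir.east) {T' a b : ℕ}
    {e : Dir} (hT : T' < T) (h : At B i T' a b e) : b < y := by
  obtain ⟨S, rfl⟩ : ∃ S, T = S + 1 := ⟨T - 1, by omega⟩
  have := h.inv
  rcases At.cases_succ (T := S) ai (by omega) with ⟨hh, _⟩ | ⟨_, y1, d1, rfl, _, ha, hb⟩
  · simp at hh
  · have := (ha.mono h (by omega)).2
    omega

/-- Before reaching the crossing vertically, the pipe is strictly below it. -/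
theorem At.before_north {B : Grid} {i T x y : ℕ} (ai : At B i T x y Dir.north) {T' a b : ℕ}
    {e : Dir} (hT : T' < T) (h : At B i T' a b e) : x < a := by
  obtain ⟨S, rfl⟩ : ∃ S, T = S + 1 := ⟨T - 1, by omega⟩
  have := h.inv
  rcases At.cases_succ (T := S) ai (by omega) with ⟨_, _, d1, ha, hb⟩ | ⟨hh, _⟩
  · have := (ha.mono h (by omega)).1
    omega
  · simp at hh

theorem backAux_col {g : Grid} {b q : ℕ} (fuel : ℕ) : ∀ {a : ℕ},
    (∀ c, a ≤ c → c ≤ g.n → g.tile c b = Tile.vert ∨ g.tile c b = Tile.cross) →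
    backAux g fuel a b true = some q → q = b := by
  induction fuel with
  | zero => intro a _ h; simp [backAux] at h
  | succ f ih =>
    intro a ht h
    rw [backAux] at h
    by_cases ha : g.n < a
    · simp [ha] at h
    · rw [if_neg ha, if_pos rfl] at h
      have ih' := ih (a := a + 1) (fun c hc hc' => ht c (by omega) hc')
      rcases ht a (le_refl _) (by omega) with h1 | h1
      · rw [h1] at h
        simp only at h
        split_ifs at h with h2
        · simpa using h.symm
        · exact ih' h
      · rw [h1] at h
        simp only at h
        split_ifs at h with h2
        · simpa using h.symm
        · exact ih' h

/-- In the bump case, the new pipe does not cross pipe `i`. -/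
theorem no_crossing {v : Perm'} {B g : Grid} {i j T x y k l : ℕ} (C : Ctx v B i j T x y)
    (D : Droop1 B g x y k l) (hxk : x + k ≤ B.n) (hyl : y + l ≤ B.n)
    (hc : B.tile (x + k) (y + l) = Tile.se) {fuel q : ℕ} {w : ℕ × ℕ}
    (hq : backAux g fuel (x + k) (y + l) false = some q)
    (hw : findCrossing g i q = some w) : False := by
  obtain ⟨hx, hxn, hy, hyn⟩ := C.bd
  have hQ := C.noQ
  have hk := D.hk
  have hl := D.hl
  have hg := C.hB.1
  have hcol := col_down hg (a := x + k) (b := y + l) (by omega) (by omega) hyl (by rw [hc]; rfl)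
    (fun a h1 h2 => (hQ a (y + l) (by omega) h2 (by omega) hyl).1)
  have hrow := row_right hg (a := x + k) (b := y + l) (by omega) (by omega) hxk (by rw [hc]; rfl)
    (fun a h1 h2 => (hQ (x + k) a (by omega) hxk (by omega) h2).1)
  have hgc : g.tile (x + k) (y + l) = Tile.bump := by rw [D.tC, hc]; rfl
  have hgcol : ∀ c, x + k < c → c ≤ g.n →
      g.tile c (y + l) = Tile.vert ∨ g.tile c (y + l) = Tile.cross := by
    intro c h1 h2
    rw [D.other _ _ (by unfold OnBd; omega)]
    exact hcol c h1 (by rw [← D.n]; exact h2)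
  have hgrow : ∀ c, y + l < c → c ≤ g.n →
      g.tile (x + k) c = Tile.horiz ∨ g.tile (x + k) c = Tile.cross := by
    intro c h1 h2
    rw [D.other _ _ (by unfold OnBd; omega)]
    exact hrow c h1 (by rw [← D.n]; exact h2)
  have hqe : q = y + l := by
    cases fuel with
    | zero => simp [backAux] at hq
    | succ f =>
      rw [backAux, if_neg (by have := D.n; omega), if_neg (by simp), hgc] at hq
      simp only at hq
      split_ifs at hq with h2
      · simpa using hq.symm
      · exact backAux_col f (fun c h1 h2 => hgcol c (by omega) h2) hq
  subst hqe
  -- pipe q in the quadrant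
  have hqQ : ∀ {T' a b d}, At g (y + l) T' a b d →
      (b = y + l ∧ x + k ≤ a ∧ d = Dir.north) ∨ (a = x + k ∧ y + l < b ∧ d = Dir.east) := by
    intro T' a b d h
    induction h with
    | start => left; refine ⟨rfl, by rw [D.n]; exact hxk, rfl⟩
    | @north T a b d h1 h2 h3 ih =>
      have hin := h1.inv
      have hin2 := h1.inv2 (by omega) (by rw [D.n]; exact hyl)
      rcases ih with ⟨rfl, e2, rfl⟩ | ⟨e1, e2, rfl⟩
      · left
        refine ⟨rfl, ?_, rfl⟩
        by_contra hcon
        have e3 : a + 1 = x + k := by omega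
        rw [e3, hgc] at h2
        simp [outDir] at h2
      · exfalso
        rw [e1] at h2
        rcases hgrow b e2 (by omega) with h | h <;> rw [h] at h2 <;> simp [outDir] at h2
    | @east T a b d h1 h2 h3 ih =>
      have hin := h1.inv
      have hin2 := h1.inv2 (by omega) (by rw [D.n]; exact hyl)
      rcases ih with ⟨rfl, e2, rfl⟩ | ⟨e1, e2, rfl⟩
      · right
        refine ⟨?_, by omega, rfl⟩
        by_contra hcon
        rcases hgcol a (by omega) (by omega) with h | h <;> rw [h] at h2 <;> simp [outDir] at h2
      · right
        exact ⟨e1, by omega, rfl⟩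
  have hij := C.hij
  have hj := C.hj
  have hi := C.hi
  have aig : At g i T x y Dir.east := by
    refine C.ai.transport D.n ?_
    intro T' a b e hT h
    have := C.ai.before_east hT h
    rw [D.other a b (by unfold OnBd; omega)]
  have hiQ : ∀ {T' a b d}, At g i T' a b d → x < a → y < b → False := by
    intro T' a b d h h1 h2
    rcases Nat.lt_or_ge T T' with hT | hT
    · have := aig.inv
      obtain ⟨x1, y1, d1, h3, h4, h5⟩ := h.exists_le (T + 1) (by omega) (by omega)
      rcases h3.cases_succ aig.inv.1 with ⟨_, _, d2, ha, hb⟩ | ⟨_, y2, d2, _, _, ha, hb⟩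
      · have := ha.det aig
        omega
      · obtain ⟨e1, e2, e3⟩ := ha.det aig
        subst e1; subst e2; subst e3
        rw [D.z] at hb
        simp [outDir] at hb
    · have := aig.mono h hT
      omega
  obtain ⟨s, hs, hs2⟩ := List.exists_of_findSome?_eq_some hw
  obtain ⟨T1, k1⟩ := At.of_mem hi (by rw [D.n]; omega) hs
  split_ifs at hs2 with hcd
  rw [Bool.and_eq_true, onPath, Bool.or_eq_true] at hcd
  have : ∃ d, (s.1, s.2.1, d) ∈ pipePath g (y + l) := by
    rcases hcd.2 with h | h
    · exact ⟨_, by simpa using h⟩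
    · exact ⟨_, by simpa using h⟩
  obtain ⟨d, hd⟩ := this
  obtain ⟨T2, k2⟩ := At.of_mem (by omega) (by rw [D.n]; exact hyl) hd
  have := hqQ k2
  simp only at this
  exact hiQ k1 (by omega) (by omega)

/-- The result of the Huang bump. -/
structure Res (B G : Grid) (x y k l : ℕ) : Prop where
  n : G.n = B.n
  z : G.tile x y = Tile.nw
  tS : G.tile (x + k) y = Tile.se
  tE : G.tile x (y + l) = fE (B.tile x (y + l))
  tC : G.tile (x + k) (y + l) = Tile.cross
  colm : ∀ a, x < a → a < x + k → G.tile a y = Tile.horiz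
  rowm : ∀ b, y < b → b < y + l → G.tile x b = Tile.vert
  tR : ∀ b, y < b → b < y + l → G.tile (x + k) b = Tile.cross
  tD : ∀ a, x < a → a < x + k → G.tile a (y + l) = Tile.cross
  other : ∀ a b, ¬ OnBd x y k l a b → G.tile a b = B.tile a b

theorem huang_res {v : Perm'} {B : Grid} {i j T x y : ℕ} (C : Ctx v B i j T x y)
    (hf : findCrossing B i j = some (x, y)) (hH : IsBPD (huang i j B)) :
    ∃ k l, Drp B x y k l ∧ Res B (huang i j B) x y k l := by
  obtain ⟨hx, hxn, hy, hyn⟩ := C.bd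
  have hQ := C.noQ
  obtain ⟨k, l, hcor, D⟩ := droop1 C.hB.1.2.1 hx hy
  have hk := D.hk
  have hl := D.hl
  have e0 : huang i j B = huangLoop i (7 ^ (B.n * B.n) * (B.n * B.n) + 1 + 1)
      (setTile B x y Tile.bump) (x, y) := by
    rw [huang, hf]
    rfl
  have hg1 : ∀ h : IsBPD (minDroopT (setTile B x y Tile.bump) x y), False := by
    intro h
    have P := drp_of C D h D.n (fun a b _ => rfl)
    have h1 := D.tC
    rw [P.c] at h1
    exact h.2.2.1 (x + k) (y + l) ⟨by omega, by rw [D.n]; exact P.hxk, by omega,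
      by rw [D.n]; exact P.hyl⟩ h1
  rw [huangLoop, hcor] at e0
  simp only at e0
  have hin : B.tile (x + k) (y + l) ≠ Tile.horiz → x + k ≤ B.n ∧ y + l ≤ B.n := by
    intro h
    by_contra hcon
    exact h (C.hB.1.2.1 _ _ (by unfold InGrid; omega))
  generalize minDroopT (setTile B x y Tile.bump) x y = g at *
  cases ht : g.tile (x + k) (y + l)
  case nw =>
    exfalso
    have h1 := D.tC
    rw [ht] at h1
    obtain ⟨h2, h3⟩ := hin (by intro h; rw [h] at h1; simp [fC] at h1)
    have h4 := hQ (x + k) (y + l) (by omega) h2 (by omega) h3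
    revert h1 h4
    cases B.tile (x + k) (y + l) <;> simp [fC]
  case bump =>
    have h1 := D.tC
    rw [ht] at h1
    obtain ⟨h2, h3⟩ := hin (by intro h; rw [h] at h1; simp [fC] at h1)
    have h4 : B.tile (x + k) (y + l) = Tile.se := by
      have := C.hB.1.2.2.1 (x + k) (y + l) ⟨by omega, h2, by omega, h3⟩
      revert h1 this
      cases B.tile (x + k) (y + l) <;> simp [fC]
    rw [ht] at e0
    simp only at e0
    cases hb : backAux g (2 * g.n + 2) (x + k) (y + l) false with
    | none =>
      rw [hb] at e0
      simp only at e0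
      rw [e0] at hH
      exact (hg1 hH).elim
    | some q =>
      rw [hb] at e0
      simp only at e0
      cases hfc : findCrossing g i q with
      | some w => exact (no_crossing C D h2 h3 h4 hb hfc).elim
      | none =>
        rw [hfc] at e0
        simp only at e0
        have hne : ∀ a b, ¬ (a = x + k ∧ b = y + l) → (huang i j B).tile a b = g.tile a b := by
          intro a b hab
          rw [e0]
          exact if_neg hab
        have hn : (huang i j B).n = B.n := by rw [e0]; exact D.n
        have P := drp_of C D hH hn hne
        refine ⟨k, l, P, hn, ?_, ?_, ?_, ?_, ?_, ?_, ?_, ?_, ?_⟩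
        · rw [hne _ _ (by omega), D.z]
        · rw [hne _ _ (by omega), D.tS, P.colk]; rfl
        · rw [hne _ _ (by omega), D.tE]
        · rw [e0]; exact if_pos ⟨rfl, rfl⟩
        · intro a ha hb
          rw [hne _ _ (by omega), D.colm a ha hb]
        · intro a ha hb
          rw [hne _ _ (by omega), D.rowm a ha hb]
        · intro a ha hb
          rw [hne _ _ (by omega), D.tR a ha hb, P.rc a ha hb]; rfl
        · intro a ha hb
          rw [hne _ _ (by omega), D.tD a ha hb, P.cr a ha hb]; rfl
        · intro a b hab
          rw [hne _ _ (by unfold OnBd at hab; omega), D.other a b hab]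
  all_goals
    rw [ht] at e0
    simp only at e0
    rw [e0] at hH
    exact (hg1 hH).elim



/-! ### The Weigandt filling is unchanged -/

theorem swap_range'_perm {n a b : ℕ} (ha : 1 ≤ a) (han : a ≤ n) (hb : 1 ≤ b) (hbn : b ≤ n) :
    ((List.range' 1 n).map (Equiv.swap a b)).Perm (List.range' 1 n) := by
  rw [List.perm_ext_iff_of_nodup]
  · intro s
    simp only [List.mem_map, List.mem_range'_1]
    constructor
    · rintro ⟨t, ht, rfl⟩
      rw [Equiv.swap_apply_def]
      split_ifs <;> omega
    · intro hs
      refine ⟨Equiv.swap a b s, ?_, by simp⟩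
      rw [Equiv.swap_apply_def]
      split_ifs <;> omega
  · exact List.Nodup.map (Equiv.injective _) (List.nodup_range' (s := 1) (n := n))
  · exact List.nodup_range'

theorem res_blank {v : Perm'} {B G : Grid} {i j T x y k l : ℕ} (C : Ctx v B i j T x y)
    (P : Drp B x y k l) (R : Res B G x y k l) (a b : ℕ) :
    G.tile a b = Tile.blank ↔ B.tile a b = Tile.blank := by
  have hk := P.hk
  have hl := P.hl
  by_cases hbd : OnBd x y k l a b
  · unfold OnBd at hbd
    by_cases h1 : a = x ∧ b = y
    · obtain ⟨rfl, rfl⟩ := h1; rw [R.z, C.z]; simp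
    by_cases h2 : a = x + k ∧ b = y
    · obtain ⟨rfl, rfl⟩ := h2; rw [R.tS, P.colk]; simp
    by_cases h3 : a = x ∧ b = y + l
    · obtain ⟨rfl, rfl⟩ := h3; rw [R.tE]; rcases P.rowl with h | h <;> rw [h] <;> simp [fE]
    by_cases h4 : a = x + k ∧ b = y + l
    · obtain ⟨rfl, rfl⟩ := h4; rw [R.tC, P.c]; simp
    by_cases h5 : a = x
    · subst h5; rw [R.rowm b (by omega) (by omega), P.rowc b (by omega) (by omega)]; simp
    by_cases h6 : a = x + k
    · subst h6; rw [R.tR b (by omega) (by omega), P.rc b (by omega) (by omega)]; simp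
    by_cases h7 : b = y
    · subst h7; rw [R.colm a (by omega) (by omega), P.colc a (by omega) (by omega)]; simp
    · have h8 : b = y + l := by omega
      subst h8; rw [R.tD a (by omega) (by omega), P.cr a (by omega) (by omega)]; simp
  · rw [R.other a b hbd]

theorem res_hasE {v : Perm'} {B G : Grid} {i j T x y k l : ℕ} (C : Ctx v B i j T x y)
    (P : Drp B x y k l) (R : Res B G x y k l) (a b : ℕ)
    (h : ¬ (y ≤ b ∧ b < y + l ∧ (a = x ∨ a = x + k))) :
    hasE (G.tile a b) = hasE (B.tile a b) := by
  have hk := P.hk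
  have hl := P.hl
  by_cases hbd : OnBd x y k l a b
  · unfold OnBd at hbd
    by_cases h3 : a = x ∧ b = y + l
    · obtain ⟨rfl, rfl⟩ := h3; rw [R.tE]; rcases P.rowl with h | h <;> rw [h] <;> rfl
    by_cases h4 : a = x + k ∧ b = y + l
    · obtain ⟨rfl, rfl⟩ := h4; rw [R.tC, P.c]; rfl
    by_cases h7 : b = y
    · subst h7; rw [R.colm a (by omega) (by omega), P.colc a (by omega) (by omega)]; rfl
    · have h8 : b = y + l := by omega
      subst h8; rw [R.tD a (by omega) (by omega), P.cr a (by omega) (by omega)]; rfl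
  · rw [R.other a b hbd]

theorem res_above {v : Perm'} {B G : Grid} {i j T x y k l : ℕ} (C : Ctx v B i j T x y)
    (P : Drp B x y k l) (R : Res B G x y k l) {a b : ℕ} (han : a ≤ B.n) (hbn : b ≤ B.n)
    (hbl : B.tile a b = Tile.blank) : pipesAbove G a b = pipesAbove B a b := by
  have hk := P.hk
  have hl := P.hl
  have hxk := P.hxk
  have hyl := P.hyl
  obtain ⟨hx, hxn, hy, hyn⟩ := C.bd
  rw [pipesAbove, pipesAbove, R.n]
  by_cases hcase : y = b ∧ x + k < a
  · obtain ⟨rfl, hxa⟩ := hcase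
    have hp := swap_range'_perm (n := B.n) (a := x) (b := x + k) hx hxn (by omega) hxk
    rw [← List.countP_eq_length_filter, ← List.countP_eq_length_filter,
      ← hp.countP_eq (fun t => decide (t < a) && hasE (B.tile t y)), List.countP_map]
    refine List.countP_congr ?_
    intro t _
    simp only [Function.comp]
    by_cases h1 : t = x
    · subst h1
      rw [Equiv.swap_apply_left, R.z, P.colk]
      simp [hasE]
    by_cases h2 : t = x + k
    · subst h2
      rw [Equiv.swap_apply_right, R.tS, C.z]
      simp only [hasE, Bool.and_true, decide_eq_true_eq]
      omega
    rw [Equiv.swap_apply_of_ne_of_ne h1 h2, res_hasE C P R t y (by omega)]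
  · congr 1
    refine List.filter_congr ?_
    intro t _
    by_cases hta : t < a
    · congr 1
      refine res_hasE C P R t b ?_
      rintro ⟨h1, h2, h3⟩
      by_cases hyb : b = y
      · subst hyb
        have h4 : x < a ∧ a ≤ x + k := by omega
        by_cases h5 : a = x + k
        · rw [h5, P.colk] at hbl; simp at hbl
        · rw [P.colc a (by omega) (by omega)] at hbl; simp at hbl
      · exact (C.noQ a b (by omega) han (by omega) hbn).2 hbl
    · simp [hta]

theorem res_weigandt {v : Perm'} {B G : Grid} {i j T x y k l : ℕ} (C : Ctx v B i j T x y)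
    (P : Drp B x y k l) (R : Res B G x y k l) (lam : List ℕ) :
    weigandt B lam = weigandt G lam := by
  have hdiag : ∀ d, blanksOnDiag G d = blanksOnDiag B d := by
    intro d
    rw [blanksOnDiag, blanksOnDiag, R.n]
    refine List.filterMap_congr ?_
    intro a _
    simp only [res_blank C P R]
  rw [weigandt, weigandt]
  refine List.map_congr_left ?_
  intro r0 _
  refine List.map_congr_left ?_
  intro c0 _
  simp only [hdiag]
  congr 1
  generalize min (r0 + 1) (c0 + 1) - 1 = m
  generalize ((c0 + 1 : ℕ) : ℤ) - ((r0 + 1 : ℕ) : ℤ) = d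
  by_cases hm : m < (blanksOnDiag B d).length
  · have hmem : (blanksOnDiag B d).getD m (0, 0) ∈ blanksOnDiag B d := by
      rw [List.getD_eq_getElem _ _ hm]
      exact List.getElem_mem hm
    generalize (blanksOnDiag B d).getD m (0, 0) = p at hmem
    rw [blanksOnDiag, List.mem_filterMap] at hmem
    obtain ⟨a, ha, hh⟩ := hmem
    rw [List.mem_range'_1] at ha
    simp only at hh
    split_ifs at hh with h1 h2
    obtain rfl := Option.some.inj hh
    exact (res_above C P R (by omega) (by omega) h2).symm
  · rw [List.getD_eq_default _ _ (by omega)]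
    simp [pipesAbove]



/-! ### The permutation after the bump -/

theorem At.tail {B G : Grid} (hn : G.n = B.n) {p p' T0 a b : ℕ} {d d' : Dir}
    (h : At B p T0 a b d) (h' : At G p' T0 a b d')
    (ho : outDir (B.tile a b) d = outDir (G.tile a b) d')
    (hag : ∀ T' a' b' e, T0 < T' → At B p T' a' b' e →
      outDir (G.tile a' b') e = outDir (B.tile a' b') e) (m : ℕ) :
    ∀ {a' b' : ℕ} {e : Dir}, At B p (T0 + m + 1) a' b' e → At G p' (T0 + m + 1) a' b' e := by
  have hin := h.inv
  induction m with
  | zero =>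
    intro a' b' e k
    rcases At.cases_succ (T := T0) k hin.1 with
      ⟨rfl, k1, d1, ha, hb⟩ | ⟨rfl, y1, d1, rfl, k1, ha, hb⟩
    · obtain ⟨rfl, rfl, rfl⟩ := ha.det h
      exact At.north h' (by rw [← ho]; exact hb) k1
    · obtain ⟨rfl, rfl, rfl⟩ := ha.det h
      exact At.east h' (by rw [← ho]; exact hb) (by omega)
  | succ m ih =>
    intro a' b' e k
    rcases At.cases_succ (T := T0 + m + 1) k (by omega) with
      ⟨rfl, k1, d1, ha, hb⟩ | ⟨rfl, y1, d1, rfl, k1, ha, hb⟩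
    · exact At.north (ih ha) (by rw [hag _ _ _ _ (by omega) ha]; exact hb) k1
    · exact At.east (ih ha) (by rw [hag _ _ _ _ (by omega) ha]; exact hb) (by omega)

theorem Exits.tail {B G : Grid} (hn : G.n = B.n) {p p' T0 a b r : ℕ} {d d' : Dir}
    (h : At B p T0 a b d) (h' : At G p' T0 a b d')
    (ho : outDir (B.tile a b) d = outDir (G.tile a b) d')
    (hag : ∀ T' a' b' e, T0 < T' → At B p T' a' b' e →
      outDir (G.tile a' b') e = outDir (B.tile a' b') e) (hr : Exits B p r) : Exits G p' r := by
  obtain ⟨T, e, k1, k2⟩ := hr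
  have hT := Exits.max k1 k2 h
  rcases Nat.lt_or_ge T0 T with hlt | hge
  · obtain ⟨m, rfl⟩ : ∃ m, T = T0 + m + 1 := ⟨T - T0 - 1, by omega⟩
    refine ⟨T0 + m + 1, e, ?_, ?_⟩
    · rw [hn]; exact At.tail hn h h' ho hag m k1
    · rw [hn, hag _ _ _ _ hlt k1]; exact k2
  · obtain rfl : T = T0 := by omega
    obtain ⟨rfl, rfl, rfl⟩ := h.det k1
    refine ⟨T, d', ?_, ?_⟩
    · rw [hn]; exact h'
    · rw [hn, ← ho]; exact k2

section
variable {v v' : Perm'} {B G : Grid} {i j T x y k l : ℕ}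

theorem Ctx.ri (C : Ctx v B i j T x y) : v.symm j < v.symm i ∧ v.symm i ≤ x ∧ 1 ≤ v.symm j := by
  have hij := C.hij
  have hj := C.hj
  have hi := C.hi
  have ei := C.hB.exits hi (by omega)
  have ej := C.hB.exits (by omega : 1 ≤ j) hj
  refine ⟨(cross_order C.hB.1 hij hi hj C.ai C.aj ei ej).2.2, ?_, (ej.le (by omega) hj).1⟩
  obtain ⟨T', e, k1, k2⟩ := ei
  exact (k1.mono C.ai (Exits.max k1 k2 C.ai)).1

/-- Pipe `j` in column `y`. -/
theorem Ctx.aj_col (C : Ctx v B i j T x y) (P : Drp B x y k l) (m : ℕ) :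
    m ≤ k → At B j (T - m) (x + m) y Dir.north := by
  have hxk := P.hxk
  induction m with
  | zero => intro _; exact C.aj
  | succ m ih =>
    intro hm
    have h := ih (by omega)
    have hin := h.inv
    have hin2 := C.aj.inv
    obtain ⟨S, hS⟩ : ∃ S, T - m = S + 1 := ⟨T - m - 1, by omega⟩
    rw [hS] at h
    rcases At.cases_succ (T := S) h (by omega) with ⟨_, _, d1, ha, hb⟩ | ⟨hh, _⟩
    · have e : T - (m + 1) = S := by omega
      rw [e]
      have hd : d1 = Dir.north := by
        by_cases h1 : m + 1 = k
        · rw [show x + m + 1 = x + k by omega, P.colk] at hb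
          cases d1
          · rfl
          · simp [outDir] at hb
        · rw [P.colc (x + m + 1) (by omega) (by omega)] at hb
          cases d1
          · rfl
          · simp [outDir] at hb
      rw [hd] at ha
      exact ha
    · simp at hh

/-- Pipe `i` in row `x`. -/
theorem Ctx.ai_row (C : Ctx v B i j T x y) (P : Drp B x y k l) (m : ℕ) (hm : m ≤ l) :
    At B i (T + m) x (y + m) Dir.east := by
  have hyl := P.hyl
  refine At.row_right m C.ai (by omega) ?_
  intro c h1 h2
  by_cases h3 : c = y
  · subst h3; rw [C.z]; rfl
  · rw [P.rowc c (by omega) (by omega)]; rfl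

theorem Drp.colq (C : Ctx v B i j T x y) (P : Drp B x y k l) : ∀ c, x + k < c → c ≤ B.n →
    B.tile c (y + l) = Tile.vert ∨ B.tile c (y + l) = Tile.cross := by
  have hk := P.hk
  have hl := P.hl
  refine col_down C.hB.1 (by omega) (by omega) P.hyl (by rw [P.c]; rfl) ?_
  intro a h1 h2
  exact (C.noQ a (y + l) (by omega) h2 (by omega) P.hyl).1

theorem Drp.rowq (C : Ctx v B i j T x y) (P : Drp B x y k l) : ∀ c, y + l < c → c ≤ B.n →
    B.tile (x + k) c = Tile.horiz ∨ B.tile (x + k) c = Tile.cross := by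
  have hk := P.hk
  have hl := P.hl
  refine row_right C.hB.1 (by omega) (by omega) P.hxk (by rw [P.c]; rfl) ?_
  intro a h1 h2
  exact (C.noQ (x + k) a (by omega) P.hxk (by omega) h2).1

theorem Drp.aq (C : Ctx v B i j T x y) (P : Drp B x y k l) :
    At B (y + l) (y + l + (B.n - (x + k))) (x + k) (y + l) Dir.north :=
  At.straight_up (by have := P.hk; omega) P.hxk (P.colq C)

theorem Drp.exq (C : Ctx v B i j T x y) (P : Drp B x y k l) : Exits B (y + l) (x + k) :=
  Exits.of_straight (P.aq C) P.hyl (by rw [P.c]; rfl) (P.rowq C)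

theorem Res.at_i (C : Ctx v B i j T x y) (R : Res B G x y k l) : ∀ {T' a b e},
    At B i T' a b e → T' ≤ T → At G i T' a b e := by
  intro T' a b e h hT
  refine h.transport R.n ?_
  intro T1 a1 b1 e1 hT1 h1
  have := C.ai.before_east (by omega : T1 < T) h1
  rw [R.other _ _ (by unfold OnBd; omega)]

theorem j_after (C : Ctx v B i j T x y) {T' a b e} (hT : T < T') (h : At B j T' a b e) :
    a < x := by
  have hin := C.aj.inv
  obtain ⟨x1, y1, d1, h3, h4, h5⟩ := h.exists_le (T + 1) (by omega) (by omega)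
  rcases h3.cases_succ hin.1 with ⟨_, _, d2, ha, hb⟩ | ⟨_, y2, d2, _, _, ha, hb⟩
  · have := ha.det C.aj
    omega
  · obtain ⟨e1, e2, e3⟩ := ha.det C.aj
    subst e1; subst e2; subst e3
    rw [C.z] at hb
    simp [outDir] at hb

theorem Res.at_i_tail (C : Ctx v B i j T x y) (R : Res B G x y k l) {T' a b e}
    (hT : T < T') (h : At B j T' a b e) : At G i T' a b e := by
  obtain ⟨m, rfl⟩ : ∃ m, T' = T + m + 1 := ⟨T' - T - 1, by omega⟩
  refine At.tail R.n C.aj (R.at_i C C.ai (le_refl _)) (by rw [C.z, R.z]; rfl) ?_ m h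
  intro T1 a1 b1 e1 h1 h2
  have := j_after C h1 h2
  rw [R.other _ _ (by unfold OnBd; omega)]

theorem Res.ex_i (C : Ctx v B i j T x y) (R : Res B G x y k l) {r} (h : Exits B j r) :
    Exits G i r := by
  refine Exits.tail R.n C.aj (R.at_i C C.ai (le_refl _)) (by rw [C.z, R.z]; rfl) ?_ h
  intro T1 a1 b1 e1 h1 h2
  have := j_after C h1 h2
  rw [R.other _ _ (by unfold OnBd; omega)]

theorem Res.ex_j (C : Ctx v B i j T x y) (P : Drp B x y k l) (R : Res B G x y k l) :
    Exits G j (x + k) := by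
  have h0 := C.aj_col P k (le_refl _)
  have h1 : At G j (T - k) (x + k) y Dir.north := by
    refine h0.transport R.n ?_
    intro T1 a1 b1 e1 hT1 h2
    have := h0.before_north hT1 h2
    rw [R.other _ _ (by unfold OnBd; omega)]
  have hyl := P.hyl
  refine Exits.of_straight h1 (by rw [R.n]; omega) (by rw [R.tS]; rfl) ?_
  intro c hc hcn
  rw [R.n] at hcn
  rcases Nat.lt_trichotomy c (y + l) with h | h | h
  · right; exact R.tR c hc h
  · right; rw [h]; exact R.tC
  · rw [R.other _ _ (by unfold OnBd; omega)]
    exact P.rowq C c h hcn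

theorem Res.at_q (C : Ctx v B i j T x y) (P : Drp B x y k l) (R : Res B G x y k l) :
    At G (y + l) (T + l) x (y + l) Dir.north := by
  obtain ⟨hx, hxn, hy, hyn⟩ := C.bd
  have h := At.straight_up (g := G) (a := x) (b := y + l) hx (by rw [R.n]; exact hxn) (by
    intro c h1 h2
    rw [R.n] at h2
    rcases Nat.lt_trichotomy c (x + k) with h | h | h
    · right; exact R.tD c h1 h
    · right; rw [h]; exact R.tC
    · rw [R.other _ _ (by unfold OnBd; omega)]
      exact P.colq C c h h2)
  have hin := C.aj.inv
  rw [R.n, show y + l + (B.n - x) = T + l by omega] at h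
  exact h

theorem Res.ex_q (C : Ctx v B i j T x y) (P : Drp B x y k l) (R : Res B G x y k l) {r}
    (h : Exits B i r) : Exits G (y + l) r := by
  have hi := C.ai_row P l (le_refl _)
  refine Exits.tail R.n hi (R.at_q C P) ?_ ?_ h
  · rw [R.tE]
    rcases P.rowl with h | h <;> rw [h] <;> rfl
  · intro T1 a1 b1 e1 h1 h2
    have hm := h2.mono hi (by omega)
    have hin := hi.inv
    have hin2 := h2.inv
    rw [R.other _ _ (by unfold OnBd; omega)]

theorem Res.agree (C : Ctx v B i j T x y) (P : Drp B x y k l) (R : Res B G x y k l) {p : ℕ}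
    (hp : 1 ≤ p) (hpn : p ≤ B.n) (hpi : p ≠ i) (hpj : p ≠ j) (hpq : p ≠ y + l) {T' a b e}
    (h : At B p T' a b e) : outDir (G.tile a b) e = outDir (B.tile a b) e := by
  have hk := P.hk
  have hl := P.hl
  have hin := h.inv
  have hzi := C.ai.inv
  have hval := h.valid C.hB.1 hp hpn
  by_cases hbd : OnBd x y k l a b
  · unfold OnBd at hbd
    have notj : b = y → e = Dir.north → False := by
      intro h1 h2
      subst h1; subst h2
      have h3 := C.aj_col P (a - x) (by omega)
      rw [show x + (a - x) = a by omega, show T - (a - x) = T' by omega] at h3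
      exact hpj (h.inj h3)
    have noti : a = x → e = Dir.east → False := by
      intro h1 h2
      subst h1; subst h2
      have h3 := C.ai_row P (b - y) (by omega)
      rw [show y + (b - y) = b by omega, show T + (b - y) = T' by omega] at h3
      exact hpi (h.inj h3)
    cases e
    · -- north
      have hby : b ≠ y := fun h1 => notj h1 rfl
      by_cases h3 : a = x ∧ b = y + l
      · obtain ⟨rfl, rfl⟩ := h3
        rcases P.rowl with h | h <;> rw [h] at hval <;> simp [Valid, hasS] at hval
      by_cases h4 : a = x + k ∧ b = y + l
      · obtain ⟨rfl, rfl⟩ := h4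
        have h5 := P.aq C
        rw [show y + l + (B.n - (x + k)) = T' by have := P.hxk; omega] at h5
        exact (hpq (h.inj h5)).elim
      by_cases h5 : a = x
      · subst h5; rw [R.rowm b (by omega) (by omega), P.rowc b (by omega) (by omega)]; rfl
      by_cases h6 : a = x + k
      · subst h6; rw [R.tR b (by omega) (by omega), P.rc b (by omega) (by omega)]; rfl
      · have h8 : b = y + l := by omega
        subst h8
        rw [P.cr a (by omega) (by omega)] at hval; simp [Valid, hasS] at hval
    · have hax : a ≠ x := fun h1 => noti h1 rfl
      by_cases h2 : a = x + k ∧ b = y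
      · obtain ⟨rfl, rfl⟩ := h2; rw [P.colk] at hval; simp [Valid, hasW] at hval
      by_cases h4 : a = x + k ∧ b = y + l
      · obtain ⟨rfl, rfl⟩ := h4; rw [P.c] at hval; simp [Valid, hasW] at hval
      by_cases h6 : a = x + k
      · subst h6; rw [P.rc b (by omega) (by omega)] at hval; simp [Valid, hasW] at hval
      by_cases h7 : b = y
      · subst h7; rw [R.colm a (by omega) (by omega), P.colc a (by omega) (by omega)]; rfl
      · have h8 : b = y + l := by omega
        subst h8; rw [R.tD a (by omega) (by omega), P.cr a (by omega) (by omega)]; rfl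
  · rw [R.other a b hbd]

theorem Res.at_other (C : Ctx v B i j T x y) (P : Drp B x y k l) (R : Res B G x y k l) {p : ℕ}
    (hp : 1 ≤ p) (hpn : p ≤ B.n) (hpi : p ≠ i) (hpj : p ≠ j) (hpq : p ≠ y + l) {T' a b e}
    (h : At B p T' a b e) : At G p T' a b e :=
  h.transport R.n (fun _ _ _ _ _ h1 => R.agree C P hp hpn hpi hpj hpq h1)

theorem Res.ex_other (C : Ctx v B i j T x y) (P : Drp B x y k l) (R : Res B G x y k l) {p r : ℕ}
    (hp : 1 ≤ p) (hpn : p ≤ B.n) (hpi : p ≠ i) (hpj : p ≠ j) (hpq : p ≠ y + l)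
    (h : Exits B p r) : Exits G p r := by
  obtain ⟨T', e, k1, k2⟩ := h
  refine ⟨T', e, ?_, ?_⟩
  · rw [R.n]; exact R.at_other C P hp hpn hpi hpj hpq k1
  · rw [R.n, R.agree C P hp hpn hpi hpj hpq k1]; exact k2

theorem at_time (C : Ctx v B i j T x y) {p s t : ℕ} (hpn : p ≤ B.n)
    (h : Exits B p s) (h1 : p ≤ t) (h2 : t + s ≤ B.n + B.n) :
    ∃ a b d, At B p t a b d := by
  obtain ⟨T', e, k1, k2⟩ := h
  have := k1.inv
  obtain ⟨a, b, d, h3, _⟩ := k1.exists_le t h1 (by omega)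
  exact ⟨a, b, d, h3⟩

theorem main_shape (C : Ctx v B i j T x y) (P : Drp B x y k l) (R : Res B G x y k l)
    (hv' : Vexillary v') (hG : MemBPD v' G) : shapeOf v B.n = shapeOf v' B.n := by
  have hi := C.hi
  have hij := C.hij
  have hj := C.hj
  have hk := P.hk
  have hl := P.hl
  have hxk := P.hxk
  have hyl := P.hyl
  have hB := C.hB
  have hGn := R.n
  obtain ⟨hx, hxn, hy, hyn⟩ := C.bd
  obtain ⟨hr1, hr2, hr3⟩ := C.ri
  have hzi := C.ai.inv
  have hzj := C.aj.inv
  have ei := hB.exits hi (by omega)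
  have ej := hB.exits (by omega : 1 ≤ j) hj
  have eq := P.exq C
  have eq' := eq.unique (hB.exits (by omega) hyl)
  have fi := (R.ex_i C ej).unique (hG.exits hi (by omega))
  have fj := (R.ex_j C P).unique (hG.exits (by omega) (by omega))
  have fq := (R.ex_q C P ei).unique (hG.exits (by omega) (by omega))
  generalize hri : v.symm i = ri at *
  generalize hrj : v.symm j = rj at *
  have vi : v ri = i := by rw [← hri]; simp
  have vj : v rj = j := by rw [← hrj]; simp
  have vq : v (x + k) = y + l := by rw [eq']; simp
  have wi : v' rj = i := by rw [fi]; simp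
  have wj : v' (x + k) = j := by rw [fj]; simp
  have wq : v' ri = y + l := by rw [fq]; simp
  have ho : ∀ s, s ≠ rj → s ≠ ri → s ≠ x + k → v' s = v s := by
    intro s h1 h2 h3
    have n1 : v s ≠ i := fun h => h2 (v.injective (h.trans vi.symm))
    have n2 : v s ≠ j := fun h => h1 (v.injective (h.trans vj.symm))
    have n3 : v s ≠ y + l := fun h => h3 (v.injective (h.trans vq.symm))
    by_cases h0 : v s = 0
    · have : s = 0 := v.injective (h0.trans hB.2.1.symm)
      rw [this, hB.2.1, hG.2.1]
    by_cases hn : B.n < v s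
    · have : v s = s := v.injective (hB.2.2.1 _ hn)
      rw [this, hG.2.2.1 s (by omega)]
    · have e1 := hB.exits (c := v s) (by omega) (by omega)
      rw [Equiv.symm_apply_apply] at e1
      have e2 := (R.ex_other C P (by omega) (by omega) n1 n2 n3 e1).unique
        (hG.exits (by omega) (by omega))
      conv_lhs => rw [e2]
      simp
  have hex : ∀ s, 1 ≤ v s → v s ≤ B.n → Exits B (v s) s := by
    intro s h1 h2
    have e1 := hB.exits (c := v s) h1 h2
    rwa [Equiv.symm_apply_apply] at e1
  have hbump := hB.1.2.2.1
  refine shape_eq (a := rj) (b := ri) (c := x + k) hr1 (by omega) hr3 hxk (by omega) (by omega)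
    (by omega) (by omega) (by omega) ho ?_ ?_ ?_ ?_
  · intro s h1 h2 h3
    rw [vi] at h3
    have h4 := ho s (by omega) (by omega) (by omega)
    exact hv'.2 ⟨rj, s, ri, x + k, hr3, h1, h2, by omega, by omega, by omega, by omega⟩
  · rintro s h1 h2 ⟨h3, h4⟩
    rw [vi] at h3
    rw [vj] at h4
    have es := hex s (by omega) (by omega)
    generalize v s = p at *
    obtain ⟨xp, yp, dp, hp⟩ := at_time C (t := T) (by omega) es (by omega) (by omega)
    have hpin := hp.inv
    rcases Nat.lt_trichotomy xp x with hlt | heq | hgt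
    · have m1 : ∃ T0 a b e e', T0 < T ∧ At B i T0 a b e ∧ At B p T0 a b e' := by
        by_contra hcon
        have := order_init h3 T C.ai hp (fun T0 hT0 a b e e' k1 k2 =>
          hcon ⟨T0, a, b, e, e', hT0, k1, k2⟩)
        omega
      have m2 : ∃ T0 a b e e', T < T0 ∧ At B p T0 a b e ∧ At B j T0 a b e' := by
        by_contra hcon
        have := exit_order (by omega) hj hp C.aj hlt (fun T0 hT0 a b e e' k1 k2 =>
          hcon ⟨T0, a, b, e, e', hT0, k1, k2⟩) es ej
        omega
      obtain ⟨T0, a0, b0, e0, e0', t0, k0, k0'⟩ := m1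
      obtain ⟨T1, a1, b1, e1, e1', t1, k1, k1'⟩ := m2
      have g0 := R.at_i C k0 (by omega)
      have g1 := R.at_i_tail C t1 k1'
      have g0' := R.at_other C P (by omega) (by omega) (by omega) (by omega) (by omega) k0'
      have g1' := R.at_other C P (by omega) (by omega) (by omega) (by omega) (by omega) k1
      have := meet_unique hG.1 g0 g0' g1 g1' (by omega) hi (by omega) (by omega) (by omega)
      omega
    · subst heq
      obtain rfl : yp = y := by omega
      cases dp
      · have := hp.inj C.aj; omega
      · have := hp.inj C.ai; omega
    · have := inQ_exit C.noQ hbump (by omega) (by omega) (by omega) hp hgt (by omega) es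
      omega
  · rintro s h1 h2 ⟨h3, h4⟩
    rw [vj] at h3
    rw [vq] at h4
    have es := hex s (by omega) (by omega)
    generalize v s = p at *
    by_cases hpy : y < p
    · have hS := P.rowc p hpy h4
      have hcol := col_down hB.1 (a := x) (b := p) hx (by omega) (by omega) (by rw [hS]; rfl)
        (fun a h5 h6 => (C.noQ a p h5 h6 hpy (by omega)).1)
      have ap := At.straight_up hx hxn hcol
      have ai := C.ai_row P (p - y) (by omega)
      rw [show y + (p - y) = p by omega, show T + (p - y) = p + (B.n - x) by omega] at ai
      have := cross_order hB.1 (by omega) hi (by omega) ai ap ei es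
      omega
    · by_cases hsx : x < s
      · have hjs := C.aj_col P (s - x) (by omega)
        rw [show x + (s - x) = s by omega] at hjs
        obtain ⟨xp, yp, dp, hp⟩ := at_time C (t := T - (s - x)) (by omega) es (by omega) (by omega)
        have hpin := hp.inv
        have := noncross_order hB.1 h3 (by omega) (by omega) hjs hp ej es (by omega)
        have := inQ_exit C.noQ hbump (by omega) (by omega) (by omega) hp (by omega) (by omega) es
        omega
      · obtain ⟨xp, yp, dp, hp⟩ := at_time C (t := T) (by omega) es (by omega) (by omega)
        have hpin := hp.inv
        have := noncross_order hB.1 h3 (by omega) (by omega) C.aj hp ej es (by omega)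
        have := inQ_exit C.noQ hbump (by omega) (by omega) (by omega) hp (by omega) (by omega) es
        omega
  · rintro s h1 ⟨h3, h4⟩
    exact C.hv.2 ⟨rj, ri, x + k, s, hr3, hr1, by omega, h1, by omega, h3, h4⟩

end


theorem mem_out {g : Grid} (hg : IsBPD g) {p : ℕ} (hp : ¬ (1 ≤ p ∧ p ≤ g.n)) {s : ℕ × ℕ × Dir}
    (hs : s ∈ pipePath g p) : g.tile s.1 s.2.1 ≠ Tile.cross := by
  have ht : g.tile g.n p = Tile.horiz := hg.2.1 _ _ (by unfold InGrid; omega)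
  unfold pipePath at hs
  rw [pathAux, ht] at hs
  simp only [outDir, List.mem_singleton] at hs
  subst hs
  simp only [ht]
  simp

theorem mem_unique {v v' : Perm'} {g : Grid} (h : MemBPD v g) (h' : MemBPD v' g) : v = v' := by
  have key : ∀ c, v.symm c = v'.symm c := by
    intro c
    by_cases h0 : c = 0
    · subst h0
      rw [(Equiv.symm_apply_eq v).2 h.2.1.symm, (Equiv.symm_apply_eq v').2 h'.2.1.symm]
    · by_cases hn : c ≤ g.n
      · exact (h.exits (by omega) hn).unique (h'.exits (by omega) hn)
      · rw [(Equiv.symm_apply_eq v).2 (h.2.2.1 c (by omega)).symm,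
          (Equiv.symm_apply_eq v').2 (h'.2.2.1 c (by omega)).symm]
  have : v.symm = v'.symm := Equiv.ext key
  rw [← Equiv.symm_symm v, this, Equiv.symm_symm]

theorem ctx_of {v : Perm'} {B : Grid} {i j x y : ℕ} (hv : Vexillary v) (hB : MemBPD v B)
    (hij : i < j) (hf : findCrossing B i j = some (x, y)) : ∃ T, Ctx v B i j T x y := by
  obtain ⟨s, hs, hs2⟩ := List.exists_of_findSome?_eq_some hf
  obtain ⟨a, b, d⟩ := s
  split_ifs at hs2 with hc
  simp only [Option.some.injEq, Prod.mk.injEq] at hs2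
  obtain ⟨rfl, rfl⟩ := hs2
  simp only [Bool.and_eq_true, beq_iff_eq, onPath, Bool.or_eq_true, decide_eq_true_eq] at hc
  obtain ⟨hc, ho⟩ := hc
  obtain ⟨d', hd'⟩ : ∃ d', (a, b, d') ∈ pipePath B j := by
    rcases ho with ho | ho
    exacts [⟨_, ho⟩, ⟨_, ho⟩]
  have hi : 1 ≤ i ∧ i ≤ B.n := by
    by_contra hcon
    exact mem_out hB.1 hcon hs hc
  have hj : 1 ≤ j ∧ j ≤ B.n := by
    by_contra hcon
    exact mem_out hB.1 hcon hd' hc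
  obtain ⟨T, ai⟩ := At.of_mem hi.1 hi.2 hs
  obtain ⟨T', aj⟩ := At.of_mem hj.1 hj.2 hd'
  simp only at ai aj
  have e1 := ai.inv
  have e2 := aj.inv
  obtain rfl : T = T' := by omega
  obtain ⟨rfl, rfl, _⟩ := cross_order hB.1 hij hi.1 hj.2 ai aj (hB.exits hi.1 hi.2)
    (hB.exits hj.1 hj.2)
  exact ⟨T, ⟨hv, hB, hi.1, hij, hj.2, ai, aj⟩⟩

/-- If `B` and `B' = H_{ij}(B)` are both bumpless pipe dreams for
vexillary permutations, then the Weigandt tableaux coincide: `γ(B) = γ(B')`. -/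
theorem stmt10 (v v' : Perm') (hv : Vexillary v) (hv' : Vexillary v')
    (i j : ℕ) (hij : i < j) (hval : v j < v i) (B : Grid) (hB : MemBPD v B)
    (hB' : MemBPD v' (huang i j B)) :
    weigandt B (shapeOf v B.n) = weigandt (huang i j B) (shapeOf v' (huang i j B).n) := by
  cases hf : findCrossing B i j with
  | none =>
    have he : huang i j B = B := by
      unfold huang
      rw [hf]
    rw [he] at hB' ⊢
    rw [mem_unique hB hB']
  | some z =>
    obtain ⟨x, y⟩ := z
    obtain ⟨T, C⟩ := ctx_of hv hB hij hf
    obtain ⟨k, l, P, R⟩ := huang_res C hf hB'.1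
    rw [R.n, ← main_shape C P R hv' hB']
    exact res_weigandt C P R _

end BPDPaper
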